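/- Let G be a group and let X and Y be cocompact G-trees whose vertex stabilizers all have property (E). Then the following conditions are equivalent: (1) X and Y are related by an elementary deformation; (2) X and Y define the same partition of G into elliptic and hyperbolic elements; (3) the length functions ℓ_X and ℓ_Y vanish on the same elements of G. -/

import Mathlib

universe u

/-- A `G`-tree: a simplicial tree together with an action of `G` by graph
automorphisms without inversions. -/
structure GTree (G : Type u) [Group G] : Type (u + 1) where
  V : Type u
  graph : SimpleGraph V
  isTree : graph.IsTree
  smul : G → V → V
  smul_one : ∀ x, smul 1 x = x
  smul_mul : ∀ γ δ x, smul (γ * δ) x = smul γ (smul δ x)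
  smul_adj : ∀ (γ : G) ⦃x y : V⦄, graph.Adj x y → graph.Adj (smul γ x) (smul γ y)
  no_inversions : ∀ (γ : G) (x y : V), graph.Adj x y → ¬(smul γ x = y ∧ smul γ y = x)

namespace GTree

variable {G : Type u} [Group G]

/-- Oriented edges of a `G`-tree. -/
def Edge (X : GTree G) : Type u := { p : X.V × X.V // X.graph.Adj p.1 p.2 }

/-- Initial vertex `∂₀ e` of an oriented edge. -/
def d0 {X : GTree G} (e : X.Edge) : X.V := e.1.1

/-- Terminal vertex `∂₁ e` of an oriented edge. -/
def d1 {X : GTree G} (e : X.Edge) : X.V := e.1.2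

/-- The underlying geometric (unoriented) edge. -/
def esym {X : GTree G} (e : X.Edge) : Sym2 X.V := s(e.1.1, e.1.2)

/-- Action of `G` on oriented edges. -/
def edgeSmul {X : GTree G} (γ : G) (e : X.Edge) : X.Edge :=
  ⟨(X.smul γ e.1.1, X.smul γ e.1.2), X.smul_adj γ e.2⟩

/-- Vertex stabilizer `G_x`. -/
def stab (X : GTree G) (x : X.V) : Subgroup G where
  carrier := { γ | X.smul γ x = x }
  one_mem' := X.smul_one x
  mul_mem' := by
    intro a b ha hb
    simp only [Set.mem_setOf_eq] at *
    rw [X.smul_mul, hb, ha]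
  inv_mem' := by
    intro a ha
    simp only [Set.mem_setOf_eq] at *
    conv_lhs => rw [← ha]
    rw [← X.smul_mul, inv_mul_cancel, X.smul_one]

/-- Edge stabilizer `G_e`: the elements fixing both endpoints (since the action
is without inversions, these are exactly the elements fixing the edge). -/
def edgeStab (X : GTree G) (e : X.Edge) : Subgroup G :=
  X.stab (d0 e) ⊓ X.stab (d1 e)

/-- An element of `G` is elliptic if it fixes a vertex. -/
def Elliptic (X : GTree G) (γ : G) : Prop := ∃ x, X.smul γ x = x

/-- A subgroup of `G` is elliptic if it fixes a vertex. -/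
def FixesVertex (X : GTree G) (H : Subgroup G) : Prop := ∃ x, ∀ γ ∈ H, X.smul γ x = x

/-- Two `G`-trees have the same elliptic subgroups. -/
def SameEllipticSubgroups (X Y : GTree G) : Prop :=
  ∀ H : Subgroup G, X.FixesVertex H ↔ Y.FixesVertex H

/-- The length function `ℓ_X(γ)`: the minimal vertex displacement. -/
noncomputable def transLen (X : GTree G) (γ : G) : ℕ :=
  sInf (Set.range fun x => X.graph.dist x (X.smul γ x))

/-- Cocompact: the quotient graph `G\X` is finite, i.e. there are finitely
many orbits of vertices and of edges. -/
def Cocompact (X : GTree G) : Prop :=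
  Finite (Quot fun x y : X.V => ∃ γ, X.smul γ x = y) ∧
    Finite (Quot fun e f : X.Edge => ∃ γ, edgeSmul γ e = f)

/-- Reduced: whenever `G_e = G_{∂₀ e}`, the endpoints of `e` are in the same
`G`-orbit. -/
def Reduced (X : GTree G) : Prop :=
  ∀ e : X.Edge, X.edgeStab e = X.stab (d0 e) → ∃ γ, X.smul γ (d0 e) = d1 e

/-- A nonempty `G`-invariant subtree (a nonempty invariant set of vertices that
is connected in the induced graph). -/
def IsInvariantSubtree (X : GTree G) (S : Set X.V) : Prop :=
  S.Nonempty ∧ (∀ γ, ∀ x ∈ S, X.smul γ x ∈ S) ∧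
    ∀ x ∈ S, ∀ y ∈ S, ∃ p : X.graph.Walk x y, ∀ v ∈ p.support, v ∈ S

/-- Minimal: there is no proper nonempty invariant subtree. -/
def Minimal (X : GTree G) : Prop :=
  ∀ S : Set X.V, X.IsInvariantSubtree S → S = Set.univ

/-- Strongly slide-free: minimal, and for all edges `e`, `f` with
`∂₀ e = ∂₀ f`, the inclusion `G_e ⊆ G_f` implies `f ∈ G e`. -/
def StronglySlideFree (X : GTree G) : Prop :=
  X.Minimal ∧ ∀ e f : X.Edge, d0 e = d0 f → X.edgeStab e ≤ X.edgeStab f →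
    ∃ γ, edgeSmul γ e = f

/-- Proper: `G_e ⊊ G_{∂₀ e}` for every edge `e`. -/
def Proper (X : GTree G) : Prop := ∀ e : X.Edge, X.edgeStab e < X.stab (d0 e)

/-- Locally finite: every vertex has finite valence. -/
def LocallyFinite (X : GTree G) : Prop := ∀ x : X.V, (X.graph.neighborSet x).Finite

/-- `φ` is an isomorphism of `G`-trees: an equivariant graph isomorphism. -/
def IsGIso (X Y : GTree G) (φ : X.V → Y.V) : Prop :=
  Function.Bijective φ ∧ (∀ x y, X.graph.Adj x y ↔ Y.graph.Adj (φ x) (φ y)) ∧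
    ∀ γ x, φ (X.smul γ x) = Y.smul γ (φ x)

/-- `φ : X → Y` is the collapse move performed at (the orbit of) the edge `e`:
`G_e = G_{∂₀ e}`, the endpoints of `e` lie in different `G`-orbits, and `Y` is
the equivariant quotient of `X` identifying `∂₀(γ e)` with `∂₁(γ e)` for all
`γ ∈ G`. -/
def IsCollapse (X Y : GTree G) (φ : X.V → Y.V) (e : X.Edge) : Prop :=
  X.edgeStab e = X.stab (d0 e) ∧
  (∀ γ : G, X.smul γ (d0 e) ≠ d1 e) ∧
  Function.Surjective φ ∧
  (∀ γ x, φ (X.smul γ x) = Y.smul γ (φ x)) ∧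
  (∀ u v : X.V, φ u = φ v ↔
    Relation.EqvGen (fun a b => ∃ γ : G, a = X.smul γ (d0 e) ∧ b = X.smul γ (d1 e)) u v) ∧
  (∀ a b : Y.V, a ≠ b → (Y.graph.Adj a b ↔ ∃ u v, X.graph.Adj u v ∧ φ u = a ∧ φ v = b))

/-- `Y` is obtained from `X` by a collapse move. -/
def Collapse (X Y : GTree G) : Prop := ∃ (φ : X.V → Y.V) (e : X.Edge), IsCollapse X Y φ e

/-- Elementary deformation: a finite composition of collapse moves and their
inverses (expansion moves). -/
def ElemDeformation : GTree G → GTree G → Prop := Relation.EqvGen Collapse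

end GTree

/-- A group `H` has property (E) if in every `H`-tree in which every element
of `H` is elliptic, `H` has a global fixed point. -/
def PropertyE (H : Type u) [Group H] : Prop :=
  ∀ T : GTree H, (∀ h : H, T.Elliptic h) → ∃ v : T.V, ∀ h : H, T.smul h v = v

namespace SimpleGraph

variable {V V' : Type*}

theorem IsAcyclic.exists_cut {Γ : SimpleGraph V} (h : Γ.IsAcyclic) {a b : V} (hab : Γ.Adj a b) :
    ∃ c : V → Prop, ¬(c a ↔ c b) ∧
      ∀ u v, Γ.Adj u v → s(u, v) ≠ s(a, b) → (c u ↔ c v) := by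
  refine ⟨fun u => (Γ.deleteEdges {s(a, b)}).Reachable a u, fun hc => ?_, fun u v huv hne => ?_⟩
  · exact isBridge_iff.1 (isAcyclic_iff_forall_adj_isBridge.1 h hab) (hc.1 (Reachable.refl a))
  · have hadj : (Γ.deleteEdges {s(a, b)}).Adj u v := by
      rw [deleteEdges_adj]
      exact ⟨huv, hne⟩
    exact ⟨fun hu => hu.trans hadj.reachable, fun hv => hv.trans hadj.symm.reachable⟩

theorem isAcyclic_of_exists_cut {Γ : SimpleGraph V}
    (h : ∀ a b, Γ.Adj a b → ∃ c : V → Prop, ¬(c a ↔ c b) ∧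
      ∀ u v, Γ.Adj u v → s(u, v) ≠ s(a, b) → (c u ↔ c v)) : Γ.IsAcyclic := by
  rw [isAcyclic_iff_forall_adj_isBridge]
  intro a b hab
  rw [isBridge_iff]
  rintro ⟨p⟩
  obtain ⟨c, hc, hcut⟩ := h a b hab
  apply hc
  clear hc hab
  suffices ∀ u v, (Γ.deleteEdges {s(a, b)}).Walk u v → (c u ↔ c v) from this a b p
  intro u v q
  induction q with
  | nil => rfl
  | cons hadj _ ih =>
    rw [deleteEdges_adj] at hadj
    exact (hcut _ _ hadj.1 hadj.2).trans ih

/-- Every vertex other than `z` has a neighbour closer to `z`. -/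
theorem Connected.exists_adj_dist_lt {Γ : SimpleGraph V} (h : Γ.Connected) {x z : V}
    (hne : x ≠ z) : ∃ n, Γ.Adj x n ∧ Γ.dist n z < Γ.dist x z := by
  obtain ⟨p, hp⟩ := h.exists_walk_length_eq_dist x z
  cases p with
  | nil => exact absurd rfl hne
  | cons hadj q =>
    refine ⟨_, hadj, ?_⟩
    have := dist_le q
    rw [Walk.length_cons] at hp
    omega

/-- In a tree, the neighbour of `x` closer to `z` is unique. -/
theorem IsTree.eq_of_adj_of_dist_lt {Γ : SimpleGraph V} (h : Γ.IsTree) {x z n n' : V}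
    (hn : Γ.Adj x n) (hnz : Γ.dist n z < Γ.dist x z)
    (hn' : Γ.Adj x n') (hnz' : Γ.dist n' z < Γ.dist x z) : n = n' := by
  have key : ∀ m, Γ.Adj x m → Γ.dist m z < Γ.dist x z →
      ∃ p : Γ.Walk x z, p.IsPath ∧ p.snd = m := by
    intro m hm hmz
    obtain ⟨q, hq⟩ := h.connected.exists_walk_length_eq_dist m z
    refine ⟨Walk.cons hm q, Walk.isPath_of_length_eq_dist _ ?_, by simp⟩
    have := dist_le (Walk.cons hm q)
    rw [Walk.length_cons] at this ⊢
    omega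
  obtain ⟨p, hp, rfl⟩ := key n hn hnz
  obtain ⟨q, hq, rfl⟩ := key n' hn' hnz'
  rw [(h.existsUnique_path x z).unique hp hq]

/-- The first step from `x` towards `z` does not change when `z` moves to an adjacent vertex
other than `x`. -/
theorem IsTree.dist_lt_of_adj {Γ : SimpleGraph V} (h : Γ.IsTree) {x z z' n : V}
    (hzz : Γ.Adj z z') (hx' : x ≠ z') (hn : Γ.Adj x n) (hnz : Γ.dist n z < Γ.dist x z) :
    Γ.dist n z' < Γ.dist x z' := by
  have d1 := h.dist_eq_dist_add_one_of_adj x hzz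
  have t1 := h.connected.dist_triangle (u := n) (v := z) (w := z')
  have e1 := dist_eq_one_iff_adj.2 hzz
  rcases d1 with d1 | d1
  · obtain ⟨m, hm, hmz⟩ := h.connected.exists_adj_dist_lt hx'
    have t2 := h.connected.dist_triangle (u := m) (v := z') (w := z)
    rw [dist_comm (u := z')] at t2
    rw [h.eq_of_adj_of_dist_lt hn hnz hm (by omega)]
    exact hmz
  · omega

/-- A graph fibering over a tree, with acyclic fibers and exactly one edge over every edge of the
base, is acyclic. -/
theorem isAcyclic_of_fibers {Γ : SimpleGraph V} (hΓ : Γ.IsTree) {W : SimpleGraph V'} (π : V' → V)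
    (hadj : ∀ a b, W.Adj a b → π a ≠ π b → Γ.Adj (π a) (π b))
    (hlift : ∀ x y, Γ.Adj x y → ∃ a b, π a = x ∧ π b = y ∧ W.Adj a b)
    (huniq : ∀ a b a' b', W.Adj a b → W.Adj a' b' → π a = π a' → π b = π b' → π a ≠ π b →
      a = a' ∧ b = b')
    (hcut : ∀ a b, W.Adj a b → π a = π b → ∃ c : V' → Prop, ¬(c a ↔ c b) ∧
      ∀ u v, π u = π a → π v = π a → W.Adj u v → s(u, v) ≠ s(a, b) → (c u ↔ c v)) :
    W.IsAcyclic := by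
  classical
  refine isAcyclic_of_exists_cut fun a b hab => ?_
  by_cases hπ : π a = π b
  · obtain ⟨c, hc, hcut⟩ := hcut a b hab hπ
    set x := π a with hx
    have hgate : ∀ w, ∃ g, (π w = x → g = w) ∧ (π w ≠ x → ∃ g', W.Adj g g' ∧ π g = x ∧
        Γ.Adj x (π g') ∧ Γ.dist (π g') (π w) < Γ.dist x (π w)) := by
      intro w
      by_cases hw : π w = x
      · exact ⟨w, fun _ => rfl, fun h => absurd hw h⟩
      · obtain ⟨n, hn, hlt⟩ := hΓ.connected.exists_adj_dist_lt (Ne.symm hw)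
        obtain ⟨g, g', hg, hg', hgg⟩ := hlift x n hn
        refine ⟨g, fun h => absurd h hw, fun _ => ⟨g', hgg, hg, ?_, ?_⟩⟩ <;> rw [hg'] <;> assumption
    choose gate hin hout using hgate
    refine ⟨fun w => c (gate w), ?_, ?_⟩
    · dsimp only
      rw [hin a rfl, hin b hπ.symm]
      exact hc
    · have mixed : ∀ u v, W.Adj u v → π u = x → π v ≠ x → gate u = gate v := by
        intro u v huv hu hv
        obtain ⟨g', h1, h2, h3, h4⟩ := hout v hv
        have hxv : Γ.Adj x (π v) := hu ▸ hadj u v huv (by rw [hu]; exact Ne.symm hv)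
        have : π g' = π v := hΓ.eq_of_adj_of_dist_lt h3 h4 hxv (by
          rw [dist_self, dist_eq_one_iff_adj.2 hxv]; exact one_pos)
        rw [hin u hu]
        exact (huniq _ _ _ _ huv h1 (hu.trans h2.symm) this.symm (by rw [hu]; exact Ne.symm hv)).1
      intro u v huv hne
      by_cases hu : π u = x <;> by_cases hv : π v = x
      · dsimp only
        rw [hin u hu, hin v hv]
        exact hcut u v hu hv huv hne
      · dsimp only
        rw [mixed u v huv hu hv]
      · dsimp only
        rw [mixed v u huv.symm hv hu]
      · obtain ⟨g, h1, h2, h3, h4⟩ := hout u hu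
        obtain ⟨g', h1', h2', h3', h4'⟩ := hout v hv
        have hgg : π g = π g' := by
          by_cases he : π u = π v
          · rw [← he] at h4'
            exact hΓ.eq_of_adj_of_dist_lt h3 h4 h3' h4'
          · exact hΓ.eq_of_adj_of_dist_lt h3
              (hΓ.dist_lt_of_adj (hadj u v huv he) (Ne.symm hv) h3 h4) h3' h4'
        dsimp only
        rw [(huniq _ _ _ _ h1 h1' (h2.trans h2'.symm) hgg (by rw [h2]; exact h3.ne)).1]
  · obtain ⟨c, hc, hcut⟩ := hΓ.isAcyclic.exists_cut (hadj a b hab hπ)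
    refine ⟨fun w => c (π w), hc, fun u v huv hne => ?_⟩
    by_cases he : π u = π v
    · dsimp only
      rw [he]
    · refine hcut _ _ (hadj u v huv he) fun hs => hne ?_
      rw [Sym2.eq_iff] at hs ⊢
      rcases hs with ⟨h1, h2⟩ | ⟨h1, h2⟩
      · exact Or.inl (huniq _ _ _ _ huv hab h1 h2 he)
      · exact Or.inr (huniq _ _ _ _ huv hab.symm h1 h2 he)

/-- A graph fibering over a connected graph with connected fibers and at least one edge over every
edge of the base is connected. -/
theorem connected_of_fibers {Γ : SimpleGraph V} (hΓ : Γ.Connected) {W : SimpleGraph V'}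
    (π : V' → V) (hsurj : Function.Surjective π)
    (hlift : ∀ x y, Γ.Adj x y → ∃ a b, π a = x ∧ π b = y ∧ W.Adj a b)
    (hconn : ∀ a b, π a = π b → W.Reachable a b) : W.Connected := by
  have key : ∀ x y, Γ.Walk x y → ∀ a b, π a = x → π b = y → W.Reachable a b := by
    intro x y p
    induction p with
    | nil => exact fun a b ha hb => hconn a b (ha.trans hb.symm)
    | cons hxy _ ih =>
      intro a b ha hb
      obtain ⟨a', b', ha', hb', hadj⟩ := hlift _ _ hxy
      exact (hconn a a' (ha.trans ha'.symm)).trans (hadj.reachable.trans (ih b' b hb' hb))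
  have : Nonempty V' := by
    obtain ⟨x⟩ := hΓ.nonempty
    obtain ⟨a, _⟩ := hsurj x
    exact ⟨a⟩
  refine ⟨fun a b => ?_⟩
  obtain ⟨p⟩ := hΓ.preconnected (π a) (π b)
  exact key _ _ p a b rfl rfl

/-- A vertex lying between `a` and `b` lies on every path from `a` to `b`. -/
theorem IsTree.mem_support_of_dist_add_dist {Γ : SimpleGraph V} (h : Γ.IsTree) {a y b : V}
    (hy : Γ.dist a y + Γ.dist y b = Γ.dist a b) {p : Γ.Walk a b} (hp : p.IsPath) :
    y ∈ p.support := by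
  obtain ⟨q, hq⟩ := h.connected.exists_walk_length_eq_dist a y
  obtain ⟨r, hr⟩ := h.connected.exists_walk_length_eq_dist y b
  have hqr : (q.append r).IsPath := Walk.isPath_of_length_eq_dist _ (by
    rw [Walk.length_append, hq, hr, hy])
  rw [(h.existsUnique_path a b).unique hp hqr]
  simp

/-- A nontrivial walk whose endpoints have the same image under a graph homomorphism to a tree
has two consecutive edges with the same image. -/
theorem Walk.exists_backtrack {Γ : SimpleGraph V} {T : SimpleGraph V'} (hT : T.IsTree)
    (f : V → V') (hf : ∀ u v, Γ.Adj u v → T.Adj (f u) (f v)) {x x' : V} (p : Γ.Walk x x')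
    (hp : p.length ≠ 0) (hxx : f x = f x') :
    ∃ i, i + 2 ≤ p.length ∧ f (p.getVert i) = f (p.getVert (i + 2)) := by
  obtain ⟨j, hj, hmax⟩ := Finset.exists_max_image (Finset.range (p.length + 1))
    (fun i => T.dist (f x) (f (p.getVert i))) ⟨0, by simp⟩
  rw [Finset.mem_range] at hj
  have h1 : T.dist (f x) (f (p.getVert 1)) = 1 := by
    have := hf _ _ (p.adj_getVert_succ (i := 0) (by omega))
    rw [Walk.getVert_zero] at this
    exact dist_eq_one_iff_adj.2 this
  have hj1 := hmax 1 (by rw [Finset.mem_range]; omega)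
  rw [h1] at hj1
  have hj0 : j ≠ 0 := by
    rintro rfl
    simp at hj1
  have hjl : j ≠ p.length := by
    rintro rfl
    rw [Walk.getVert_length, ← hxx] at hj1
    simp at hj1
  obtain ⟨i, rfl⟩ := Nat.exists_eq_succ_of_ne_zero hj0
  refine ⟨i, by omega, ?_⟩
  have a1 := hf _ _ (p.adj_getVert_succ (i := i) (by omega))
  have a2 := hf _ _ (p.adj_getVert_succ (i := i + 1) (by omega))
  have m1 := hmax i (by rw [Finset.mem_range]; omega)
  have m2 := hmax (i + 2) (by rw [Finset.mem_range]; omega)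
  have n1 := hT.dist_ne_of_adj (f x) a1
  have n2 := hT.dist_ne_of_adj (f x) a2
  simp only [Nat.succ_eq_add_one] at m1 m2
  apply hT.eq_of_adj_of_dist_lt (z := f x) a1.symm _ a2 _
  · rw [dist_comm, dist_comm (v := f x)]; omega
  · rw [dist_comm, dist_comm (v := f x)]; rw [add_assoc] at n2 ⊢; norm_num at n2 ⊢; omega

theorem Connected.dist_map_le {Γ : SimpleGraph V}
    {Γ' : SimpleGraph V'} (hΓ : Γ.Connected) {f : V → V'}
    (hf : ∀ u v, Γ.Adj u v → Γ'.Adj (f u) (f v)) (u v : V) :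
    Γ'.dist (f u) (f v) ≤ Γ.dist u v := by
  obtain ⟨w, hw⟩ := hΓ.exists_walk_length_eq_dist u v
  rw [← hw, ← Walk.length_map (⟨f, fun h => hf _ _ h⟩ : Γ →g Γ') w]
  exact dist_le _

end SimpleGraph

namespace GTree

open SimpleGraph

variable {G : Type u} [Group G]

theorem smul_inv_smul (X : GTree G) (g : G) (x : X.V) : X.smul g (X.smul g⁻¹ x) = x := by
  rw [← X.smul_mul, mul_inv_cancel, X.smul_one]

theorem inv_smul_smul (X : GTree G) (g : G) (x : X.V) : X.smul g⁻¹ (X.smul g x) = x := by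
  rw [← X.smul_mul, inv_mul_cancel, X.smul_one]

theorem smul_injective (X : GTree G) (g : G) : Function.Injective (X.smul g) :=
  Function.LeftInverse.injective (X.inv_smul_smul g)

theorem smul_adj_iff (X : GTree G) (g : G) {x y : X.V} :
    X.graph.Adj (X.smul g x) (X.smul g y) ↔ X.graph.Adj x y := by
  refine ⟨fun h => ?_, fun h => X.smul_adj g h⟩
  have := X.smul_adj g⁻¹ h
  rwa [inv_smul_smul, inv_smul_smul] at this

theorem dist_smul (X : GTree G) (g : G) (x y : X.V) :
    X.graph.dist (X.smul g x) (X.smul g y) = X.graph.dist x y := by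
  have key : ∀ (g : G) (x y : X.V),
      X.graph.dist (X.smul g x) (X.smul g y) ≤ X.graph.dist x y := by
    intro g x y
    obtain ⟨p, hp⟩ := X.isTree.connected.exists_walk_length_eq_dist x y
    rw [← hp, ← Walk.length_map (⟨X.smul g, fun h => X.smul_adj g h⟩ : X.graph →g X.graph) p]
    exact dist_le _
  refine le_antisymm (key g x y) ?_
  conv_lhs => rw [← X.inv_smul_smul g x, ← X.inv_smul_smul g y]
  exact key _ _ _

/-- An equivariant map of vertex sets. -/
def Equivariant {X Y : GTree G} (f : X.V → Y.V) : Prop :=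
  ∀ g x, f (X.smul g x) = Y.smul g (f x)

/-- `Y` is obtained from `X` by contracting the edges whose endpoints have the same image
under `q`. -/
structure IsContraction (X Y : GTree G) (q : X.V → Y.V) : Prop where
  surj : Function.Surjective q
  equivariant : Equivariant q
  eqvGen : ∀ u v, q u = q v → Relation.EqvGen (fun a b => X.graph.Adj a b ∧ q a = q b) u v
  adj : ∀ a b, a ≠ b → (Y.graph.Adj a b ↔ ∃ u v, X.graph.Adj u v ∧ q u = a ∧ q v = b)

section contract

variable (X : GTree G) (F : X.V → X.V → Prop)

/-- The quotient of the graph of `X` identifying `F`-related vertices. -/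
def quotGraph : SimpleGraph (Quot F) where
  Adj a b := a ≠ b ∧ ∃ u v, X.graph.Adj u v ∧ Quot.mk F u = a ∧ Quot.mk F v = b
  symm := ⟨by
    rintro a b ⟨hab, u, v, huv, rfl, rfl⟩
    exact ⟨hab.symm, v, u, huv.symm, rfl, rfl⟩⟩
  loopless := ⟨fun a h => h.1 rfl⟩

variable {X F}

/-- An edge surviving in the quotient separates the quotient. -/
theorem exists_quot_cut (hF : ∀ u v, F u v → X.graph.Adj u v) {a b : X.V}
    (hab : X.graph.Adj a b) (hne : Quot.mk F a ≠ Quot.mk F b) :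
    ∃ c : Quot F → Prop, ¬(c (Quot.mk F a) ↔ c (Quot.mk F b)) ∧
      ∀ u v, X.graph.Adj u v → s(u, v) ≠ s(a, b) → (c (Quot.mk F u) ↔ c (Quot.mk F v)) := by
  obtain ⟨c, hc, hcut⟩ := X.isTree.isAcyclic.exists_cut hab
  refine ⟨Quot.lift c fun u v huv => propext (hcut u v (hF u v huv) fun hs => hne ?_), hc, hcut⟩
  have := Quot.sound huv
  rw [Sym2.eq_iff] at hs
  rcases hs with ⟨rfl, rfl⟩ | ⟨rfl, rfl⟩
  · exact this
  · exact this.symm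

theorem eq_of_quot_eq (hF : ∀ u v, F u v → X.graph.Adj u v) {a b a' b' : X.V}
    (hab : X.graph.Adj a b) (hab' : X.graph.Adj a' b') (hne : Quot.mk F a ≠ Quot.mk F b)
    (ha : Quot.mk F a = Quot.mk F a') (hb : Quot.mk F b = Quot.mk F b') : a = a' ∧ b = b' := by
  obtain ⟨c, hc, hcut⟩ := exists_quot_cut hF hab hne
  by_contra hcon
  have hs : s(a', b') = s(a, b) := by
    by_contra hs
    have := hcut a' b' hab' hs
    rw [← ha, ← hb] at this
    exact hc this
  rw [Sym2.eq_iff] at hs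
  rcases hs with ⟨rfl, rfl⟩ | ⟨rfl, rfl⟩
  · exact hcon ⟨rfl, rfl⟩
  · exact hne ha

theorem quotGraph_isTree (hF : ∀ u v, F u v → X.graph.Adj u v) : (X.quotGraph F).IsTree := by
  refine ⟨?_, isAcyclic_of_exists_cut ?_⟩
  · have key : ∀ u v, X.graph.Walk u v →
        (X.quotGraph F).Reachable (Quot.mk F u) (Quot.mk F v) := by
      intro u v p
      induction p with
      | nil => exact Reachable.refl _
      | @cons u w _ huw _ ih =>
        by_cases he : Quot.mk F u = Quot.mk F w
        · rwa [he]
        · exact (Adj.reachable (⟨he, u, w, huw, rfl, rfl⟩ : (X.quotGraph F).Adj _ _)).trans ih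
    have : Nonempty (Quot F) := X.isTree.connected.nonempty.map (Quot.mk F)
    refine ⟨fun a b => ?_⟩
    induction a using Quot.ind with | _ u =>
    induction b using Quot.ind with | _ v =>
    obtain ⟨p⟩ := X.isTree.connected.preconnected u v
    exact key u v p
  · rintro _ _ ⟨hne, a, b, hab, rfl, rfl⟩
    obtain ⟨c, hc, hcut⟩ := exists_quot_cut hF hab hne
    refine ⟨c, hc, ?_⟩
    rintro _ _ ⟨-, u, v, huv, rfl, rfl⟩ hs
    refine hcut u v huv fun h => hs ?_
    rw [Sym2.eq_iff] at h ⊢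
    rcases h with ⟨rfl, rfl⟩ | ⟨rfl, rfl⟩ <;> simp

variable (X F)

/-- The tree obtained by contracting an invariant set of edges. -/
def contract (hF : ∀ u v, F u v → X.graph.Adj u v)
    (hG : ∀ g u v, F u v → F (X.smul g u) (X.smul g v)) : GTree G where
  V := Quot F
  graph := X.quotGraph F
  isTree := quotGraph_isTree hF
  smul g := Quot.map (X.smul g) (hG g)
  smul_one := by
    rintro ⟨x⟩
    exact congrArg (Quot.mk F) (X.smul_one x)
  smul_mul := by
    rintro γ δ ⟨x⟩
    exact congrArg (Quot.mk F) (X.smul_mul γ δ x)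
  smul_adj := by
    rintro g _ _ ⟨hne, u, v, huv, rfl, rfl⟩
    refine ⟨fun h => hne ?_, X.smul g u, X.smul g v, X.smul_adj g huv, rfl, rfl⟩
    have := congrArg (Quot.map (X.smul g⁻¹) (hG g⁻¹)) h
    change Quot.mk F (X.smul g⁻¹ (X.smul g u)) = Quot.mk F (X.smul g⁻¹ (X.smul g v)) at this
    rwa [inv_smul_smul, inv_smul_smul] at this
  no_inversions := by
    rintro g _ _ ⟨hne, u, v, huv, rfl, rfl⟩ ⟨h1, h2⟩
    obtain ⟨h3, h4⟩ := eq_of_quot_eq hF huv (X.smul_adj g huv).symm hne h2.symm h1.symm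
    exact X.no_inversions g u v huv ⟨h4.symm, h3.symm⟩

variable {X F} (hF : ∀ u v, F u v → X.graph.Adj u v)
    (hG : ∀ g u v, F u v → F (X.smul g u) (X.smul g v))

/-- The quotient map onto the contracted tree. -/
def contractMap : X.V → (X.contract F hF hG).V := Quot.mk F

theorem contractMap_surjective : Function.Surjective (contractMap hF hG) := Quot.mk_surjective

theorem contractMap_equivariant : Equivariant (contractMap hF hG) := fun _ _ => rfl

theorem contractMap_eq_iff {u v : X.V} :
    contractMap hF hG u = contractMap hF hG v ↔ Relation.EqvGen F u v :=
  ⟨Quot.eqvGen_exact, Quot.eqvGen_sound⟩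

theorem contract_adj_iff {a b : (X.contract F hF hG).V} :
    (X.contract F hF hG).graph.Adj a b ↔
      a ≠ b ∧ ∃ u v, X.graph.Adj u v ∧ contractMap hF hG u = a ∧ contractMap hF hG v = b :=
  Iff.rfl

theorem contractMap_isContraction :
    IsContraction X (X.contract F hF hG) (contractMap hF hG) where
  surj := contractMap_surjective hF hG
  equivariant := contractMap_equivariant hF hG
  eqvGen u v h := Relation.EqvGen.mono
    (fun _ _ h => ⟨hF _ _ h, Quot.sound h⟩) _ _ ((contractMap_eq_iff hF hG).1 h)
  adj a b hab := by
    rw [contract_adj_iff]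
    exact and_iff_right hab

end contract

/-- The orbit relation of an edge, contracted in a collapse move. -/
def edgeRel {X : GTree G} (e : X.Edge) (a b : X.V) : Prop :=
  ∃ γ : G, a = X.smul γ (d0 e) ∧ b = X.smul γ (d1 e)

theorem adj_of_edgeRel {X : GTree G} (e : X.Edge) (u v : X.V) (h : edgeRel e u v) :
    X.graph.Adj u v := by
  obtain ⟨g, rfl, rfl⟩ := h
  exact X.smul_adj g e.2

theorem edgeRel_smul {X : GTree G} (e : X.Edge) (g : G) (u v : X.V) (h : edgeRel e u v) :
    edgeRel e (X.smul g u) (X.smul g v) := by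
  obtain ⟨h, rfl, rfl⟩ := h
  exact ⟨g * h, by rw [X.smul_mul], by rw [X.smul_mul]⟩

/-- The tree obtained by contracting the orbit of an edge. -/
def contractEdge {X : GTree G} (e : X.Edge) : GTree G :=
  X.contract (edgeRel e) (adj_of_edgeRel e) (edgeRel_smul e)

theorem collapse_contractEdge {X : GTree G} (e : X.Edge) (h : X.edgeStab e = X.stab (d0 e))
    (hne : ∀ γ : G, X.smul γ (d0 e) ≠ d1 e) : Collapse X (contractEdge e) :=
  have hc := contractMap_isContraction (adj_of_edgeRel e) (edgeRel_smul e)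
  ⟨contractMap (adj_of_edgeRel e) (edgeRel_smul e), e, h, hne, hc.surj, hc.equivariant,
    fun _ _ => contractMap_eq_iff _ _, hc.adj⟩

/-- An edge whose endpoints are identified by an equivariant map `q` is collapsible as soon as
the stabilizer of its image is elliptic. -/
theorem exists_collapsible {X Y : GTree G} {q : X.V → Y.V} (hq : Equivariant q) {u v x : X.V}
    (huv : X.graph.Adj u v) (hquv : q u = q v)
    (hx : ∀ g, Y.smul g (q u) = q u → X.smul g x = x) :
    ∃ e : X.Edge, X.edgeStab e = X.stab (d0 e) ∧ (∀ γ : G, X.smul γ (d0 e) ≠ d1 e) ∧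
      (d0 e = u ∧ d1 e = v ∨ d0 e = v ∧ d1 e = u) := by
  wlog hlt : X.graph.dist v x < X.graph.dist u x generalizing u v
  · have hne := X.isTree.dist_ne_of_adj x huv
    rw [dist_comm, dist_comm (u := x)] at hne
    obtain ⟨e, h1, h2, h3⟩ := this huv.symm hquv.symm (by rwa [← hquv]) (by omega)
    exact ⟨e, h1, h2, h3.symm⟩
  refine ⟨⟨(u, v), huv⟩, ?_, ?_, Or.inl ⟨rfl, rfl⟩⟩
  · refine inf_eq_left.2 fun g hg => ?_
    change X.smul g u = u at hg
    change X.smul g v = v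
    have hgx : X.smul g x = x := hx g (by rw [← hq, hg])
    have h1 := X.smul_adj g huv
    have h2 := X.dist_smul g v x
    rw [hg] at h1
    rw [hgx] at h2
    exact X.isTree.eq_of_adj_of_dist_lt h1 (by omega) huv hlt
  · intro g hg
    change X.smul g u = v at hg
    have hgx : X.smul g x = x := hx g (by rw [← hq, hg, hquv])
    have h2 := X.dist_smul g u x
    rw [hg, hgx] at h2
    omega

theorem IsContraction.isGIso {X Y : GTree G} {q : X.V → Y.V} (hq : IsContraction X Y q)
    (h : ∀ u v, X.graph.Adj u v → q u ≠ q v) : IsGIso X Y q := by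
  have hinj : Function.Injective q := by
    intro u v huv
    have := hq.eqvGen u v huv
    clear huv
    induction this with
    | rel a b hab => exact absurd hab.2 (h a b hab.1)
    | refl => rfl
    | symm _ _ _ ih => exact ih.symm
    | trans _ _ _ _ _ ih ih' => exact ih.trans ih'
  refine ⟨⟨hinj, hq.surj⟩, fun x y => ⟨fun hxy => ?_, fun hxy => ?_⟩, hq.equivariant⟩
  · exact (hq.adj _ _ (h x y hxy)).2 ⟨x, y, hxy, rfl, rfl⟩
  · obtain ⟨u, v, huv, hu, hv⟩ := (hq.adj _ _ hxy.ne).1 hxy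
    rwa [← hinj hu, ← hinj hv]

/-- A contraction factors through the contraction of any smaller set of edges. -/
theorem IsContraction.factor {X Y : GTree G} {q : X.V → Y.V} (hq : IsContraction X Y q)
    {F : X.V → X.V → Prop} (hF : ∀ u v, F u v → X.graph.Adj u v)
    (hG : ∀ g u v, F u v → F (X.smul g u) (X.smul g v)) (hFq : ∀ u v, F u v → q u = q v) :
    ∃ q' : (X.contract F hF hG).V → Y.V, IsContraction (X.contract F hF hG) Y q' ∧
      ∀ x, q' (contractMap hF hG x) = q x := by
  refine ⟨Quot.lift q hFq, ⟨?_, ?_, ?_, ?_⟩, fun _ => rfl⟩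
  · intro y
    obtain ⟨x, rfl⟩ := hq.surj y
    exact ⟨Quot.mk F x, rfl⟩
  · rintro g ⟨x⟩
    exact hq.equivariant g x
  · rintro ⟨u⟩ ⟨v⟩ huv
    have := hq.eqvGen u v huv
    clear huv
    induction this with
    | rel a b hab =>
      by_cases he : Quot.mk F a = Quot.mk F b
      · rw [he]
        exact Relation.EqvGen.refl _
      · exact Relation.EqvGen.rel _ _ ⟨⟨he, a, b, hab.1, rfl, rfl⟩, hab.2⟩
    | refl => exact Relation.EqvGen.refl _
    | symm _ _ _ ih => exact Relation.EqvGen.symm _ _ ih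
    | trans _ _ _ _ _ ih ih' => exact Relation.EqvGen.trans _ _ _ ih ih'
  · intro a b hab
    rw [hq.adj a b hab]
    constructor
    · rintro ⟨u, v, huv, rfl, rfl⟩
      exact ⟨Quot.mk F u, Quot.mk F v, ⟨fun h => hab (congrArg (Quot.lift q hFq) h),
        u, v, huv, rfl, rfl⟩, rfl, rfl⟩
    · rintro ⟨_, _, ⟨-, u, v, huv, rfl, rfl⟩, hu, hv⟩
      exact ⟨u, v, huv, hu, hv⟩

/-- Every edge of `X` satisfying `P` is a translate of a pair in the list `l`, up to
orientation. -/
def EdgeCover (X : GTree G) (P : X.V → X.V → Prop) (l : List (X.V × X.V)) : Prop :=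
  ∀ u v, X.graph.Adj u v → P u v → ∃ p ∈ l, ∃ g,
    (u = X.smul g p.1 ∧ v = X.smul g p.2) ∨ (v = X.smul g p.1 ∧ u = X.smul g p.2)

theorem IsContraction.exists_elemDeformation {Y : GTree G} (n : ℕ) :
    ∀ (X : GTree G) (q : X.V → Y.V), IsContraction X Y q →
      (∀ y, ∃ x, ∀ g, Y.smul g y = y → X.smul g x = x) →
      ∀ l : List (X.V × X.V), l.length = n → EdgeCover X (fun u v => q u = q v) l →
      ∃ X' : GTree G, ElemDeformation X X' ∧ ∃ ι, IsGIso X' Y ι := by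
  induction n with
  | zero =>
    intro X q hq _ l hl hc
    rw [List.length_eq_zero_iff] at hl
    subst hl
    exact ⟨X, Relation.EqvGen.refl _, q, hq.isGIso fun u v huv he => by
      obtain ⟨p, hp, _⟩ := hc u v huv he
      simp at hp⟩
  | succ n ih =>
    intro X q hq hell l hl hc
    obtain ⟨p, l, rfl⟩ := List.exists_cons_of_length_eq_add_one hl
    rw [List.length_cons, Nat.add_right_cancel_iff] at hl
    by_cases hp : X.graph.Adj p.1 p.2 ∧ q p.1 = q p.2
    · obtain ⟨x, hx⟩ := hell (q p.1)
      obtain ⟨e, he, hne, hep⟩ := exists_collapsible hq.equivariant hp.1 hp.2 hx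
      have hF : ∀ u v, edgeRel e u v → q u = q v := by
        rintro _ _ ⟨g, rfl, rfl⟩
        rw [hq.equivariant, hq.equivariant]
        rcases hep with ⟨h1, h2⟩ | ⟨h1, h2⟩ <;> rw [h1, h2, hp.2]
      obtain ⟨q', hq', hqq'⟩ := hq.factor (adj_of_edgeRel e) (edgeRel_smul e) hF
      set φ := contractMap (adj_of_edgeRel e) (edgeRel_smul e) with hφ
      obtain ⟨X', hX', hι⟩ := ih (contractEdge e) q' hq' (fun y => by
        obtain ⟨x, hx⟩ := hell y
        refine ⟨φ x, fun g hg => ?_⟩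
        exact (contractMap_equivariant _ _ g x).symm.trans (congrArg φ (hx g hg)))
        (l.map fun p => (φ p.1, φ p.2)) (by rw [List.length_map, hl]) (by
          rintro _ _ ⟨hab, u, v, huv, rfl, rfl⟩ hquv
          obtain ⟨p', hp', g, hg⟩ := hc u v huv ((hqq' u).symm.trans (hquv.trans (hqq' v)))
          rcases List.mem_cons.1 hp' with rfl | hp'
          · refine absurd ?_ hab
            rcases hep with ⟨h1, h2⟩ | ⟨h1, h2⟩ <;> rcases hg with ⟨rfl, rfl⟩ | ⟨rfl, rfl⟩
            · exact Quot.sound ⟨g, by rw [h1], by rw [h2]⟩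
            · exact (Quot.sound ⟨g, by rw [h1], by rw [h2]⟩).symm
            · exact (Quot.sound ⟨g, by rw [h1], by rw [h2]⟩).symm
            · exact Quot.sound ⟨g, by rw [h1], by rw [h2]⟩
          · refine ⟨_, List.mem_map_of_mem hp', g, ?_⟩
            rcases hg with ⟨rfl, rfl⟩ | ⟨rfl, rfl⟩
            · exact Or.inl ⟨rfl, rfl⟩
            · exact Or.inr ⟨rfl, rfl⟩)
      exact ⟨X', Relation.EqvGen.trans _ _ _
        (Relation.EqvGen.rel _ _ (collapse_contractEdge e he hne)) hX', hι⟩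
    · refine ih X q hq hell l hl fun u v huv hquv => ?_
      obtain ⟨p', hp', g, hg⟩ := hc u v huv hquv
      rcases List.mem_cons.1 hp' with rfl | hp'
      · refine absurd ?_ hp
        rcases hg with ⟨rfl, rfl⟩ | ⟨rfl, rfl⟩
        · rw [hq.equivariant, hq.equivariant] at hquv
          exact ⟨(X.smul_adj_iff g).1 huv, Y.smul_injective g hquv⟩
        · rw [hq.equivariant, hq.equivariant] at hquv
          exact ⟨(X.smul_adj_iff g).1 huv.symm, Y.smul_injective g hquv.symm⟩
      · exact ⟨p', hp', g, hg⟩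

/-- Data for blowing up the vertices of a tree to subtrees: a map `proj` to the vertices of `X`,
a relation generating the adjacency in the fibers, and for each oriented edge `(x, y)` of `X` a
point `att x y` of the fiber over `x` to which the edge is attached. -/
structure Blowup (X : GTree G) where
  V : Type u
  smul : G → V → V
  smul_one : ∀ a, smul 1 a = a
  smul_mul : ∀ g h a, smul (g * h) a = smul g (smul h a)
  proj : V → X.V
  proj_smul : ∀ g a, proj (smul g a) = X.smul g (proj a)
  surj : Function.Surjective proj
  rel : V → V → Prop
  rel_ne : ∀ a b, rel a b → a ≠ b
  rel_proj : ∀ a b, rel a b → proj a = proj b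
  rel_smul : ∀ g a b, rel a b → rel (smul g a) (smul g b)
  no_inversions : ∀ g a b, rel a b → ¬(smul g a = b ∧ smul g b = a)
  conn : ∀ a b, proj a = proj b → Relation.EqvGen rel a b
  cut : ∀ a b, rel a b → ∃ c : V → Prop, ¬(c a ↔ c b) ∧
    ∀ u v, rel u v → proj u = proj a → s(u, v) ≠ s(a, b) → (c u ↔ c v)
  att : X.V → X.V → V
  proj_att : ∀ x y, X.graph.Adj x y → proj (att x y) = x
  att_smul : ∀ g x y, X.graph.Adj x y → att (X.smul g x) (X.smul g y) = smul g (att x y)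

namespace Blowup

variable {X : GTree G} (B : Blowup X)

/-- The edges of the blow-up lying over edges of `X`. -/
def Cross (a b : B.V) : Prop :=
  X.graph.Adj (B.proj a) (B.proj b) ∧ a = B.att (B.proj a) (B.proj b) ∧
    b = B.att (B.proj b) (B.proj a)

/-- The blown-up graph. -/
def graph : SimpleGraph B.V where
  Adj a b := B.rel a b ∨ B.rel b a ∨ B.Cross a b
  symm := ⟨by
    rintro a b (h | h | ⟨h, ha, hb⟩)
    · exact Or.inr (Or.inl h)
    · exact Or.inl h
    · exact Or.inr (Or.inr ⟨h.symm, hb, ha⟩)⟩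
  loopless := ⟨by
    rintro a (h | h | h)
    · exact B.rel_ne a a h rfl
    · exact B.rel_ne a a h rfl
    · exact h.1.ne rfl⟩

theorem cross_of_ne {a b : B.V} (h : B.graph.Adj a b) (hne : B.proj a ≠ B.proj b) :
    B.Cross a b := by
  rcases h with h | h | h
  · exact absurd (B.rel_proj _ _ h) hne
  · exact absurd (B.rel_proj _ _ h).symm hne
  · exact h

theorem rel_of_eq {a b : B.V} (h : B.graph.Adj a b) (he : B.proj a = B.proj b) :
    B.rel a b ∨ B.rel b a := by
  rcases h with h | h | h
  · exact Or.inl h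
  · exact Or.inr h
  · exact absurd he h.1.ne

theorem cross_att {x y : X.V} (h : X.graph.Adj x y) : B.Cross (B.att x y) (B.att y x) := by
  rw [Cross, B.proj_att x y h, B.proj_att y x h.symm]
  exact ⟨h, rfl, rfl⟩

theorem cross_smul (g : G) {a b : B.V} (h : B.Cross a b) :
    B.Cross (B.smul g a) (B.smul g b) := by
  obtain ⟨h1, h2, h3⟩ := h
  have := B.cross_att (X.smul_adj g h1)
  rwa [B.att_smul g _ _ h1, B.att_smul g _ _ h1.symm, ← h2, ← h3] at this

theorem lift {x y : X.V} (h : X.graph.Adj x y) :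
    ∃ a b, B.proj a = x ∧ B.proj b = y ∧ B.graph.Adj a b :=
  ⟨B.att x y, B.att y x, B.proj_att x y h, B.proj_att y x h.symm, Or.inr (Or.inr (B.cross_att h))⟩

theorem isTree : B.graph.IsTree := by
  refine ⟨connected_of_fibers X.isTree.connected B.proj B.surj (fun x y => B.lift) ?_,
    isAcyclic_of_fibers X.isTree B.proj (fun a b hab hne => (B.cross_of_ne hab hne).1)
      (fun x y => B.lift) ?_ ?_⟩
  · intro a b hab
    have := B.conn a b hab
    clear hab
    induction this with
    | rel a b h => exact Adj.reachable (Or.inl h : B.graph.Adj a b)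
    | refl => exact Reachable.refl _
    | symm _ _ _ ih => exact ih.symm
    | trans _ _ _ _ _ ih ih' => exact ih.trans ih'
  · intro a b a' b' hab hab' ha hb hne
    obtain ⟨-, h1, h2⟩ := B.cross_of_ne hab hne
    obtain ⟨-, h1', h2'⟩ := B.cross_of_ne hab' (by rwa [← ha, ← hb])
    exact ⟨by rw [h1, h1', ha, hb], by rw [h2, h2', ha, hb]⟩
  · intro a b hab he
    have key : ∀ a b, B.rel a b → ∃ c : B.V → Prop, ¬(c a ↔ c b) ∧
        ∀ u v, B.proj u = B.proj a → B.proj v = B.proj a → B.graph.Adj u v →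
          s(u, v) ≠ s(a, b) → (c u ↔ c v) := by
      intro a b hab
      obtain ⟨c, hc, hcut⟩ := B.cut a b hab
      refine ⟨c, hc, fun u v hu hv huv hne => ?_⟩
      rcases B.rel_of_eq huv (hu.trans hv.symm) with h | h
      · exact hcut u v h hu hne
      · exact (hcut v u h hv (by rwa [Sym2.eq_swap])).symm
    rcases B.rel_of_eq hab he with h | h
    · exact key a b h
    · obtain ⟨c, hc, hcut⟩ := key b a h
      refine ⟨c, fun h => hc h.symm, fun u v hu hv huv hne => ?_⟩
      exact hcut u v (hu.trans he) (hv.trans he) huv (by rwa [Sym2.eq_swap (a := b)])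

/-- The blown-up tree. -/
def tree : GTree G where
  V := B.V
  graph := B.graph
  isTree := B.isTree
  smul := B.smul
  smul_one := B.smul_one
  smul_mul := B.smul_mul
  smul_adj := by
    rintro g a b (h | h | h)
    · exact Or.inl (B.rel_smul g _ _ h)
    · exact Or.inr (Or.inl (B.rel_smul g _ _ h))
    · exact Or.inr (Or.inr (B.cross_smul g h))
  no_inversions := by
    rintro g a b (h | h | h) ⟨ha, hb⟩
    · exact B.no_inversions g a b h ⟨ha, hb⟩
    · exact B.no_inversions g b a h ⟨hb, ha⟩
    · exact X.no_inversions g _ _ h.1 ⟨by rw [← B.proj_smul, ha], by rw [← B.proj_smul, hb]⟩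

theorem isContraction : IsContraction B.tree X B.proj where
  surj := B.surj
  equivariant := B.proj_smul
  eqvGen u v h := Relation.EqvGen.mono
    (fun a b hab => ⟨Or.inl hab, B.rel_proj a b hab⟩) _ _ (B.conn u v h)
  adj a b hne := by
    refine ⟨fun hab => ?_, ?_⟩
    · obtain ⟨u, v, hu, hv, huv⟩ := B.lift hab
      exact ⟨u, v, huv, hu, hv⟩
    · rintro ⟨u, v, huv, rfl, rfl⟩
      exact (B.cross_of_ne huv hne).1

/-- A finite cover of the edges of `X` and a finite cover of the fiber edges combine to a finite
cover of the edges of the blow-up. -/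
theorem exists_edgeCover {l : List (X.V × X.V)} (hl : EdgeCover X (fun _ _ => True) l)
    {m : List (B.V × B.V)} (hm : ∀ a b, B.rel a b → ∃ p ∈ m, ∃ g,
      a = B.smul g p.1 ∧ b = B.smul g p.2) :
    ∃ l' : List (B.tree.V × B.tree.V), EdgeCover B.tree (fun _ _ => True) l' := by
  refine ⟨m ++ l.map fun p => (B.att p.1 p.2, B.att p.2 p.1), ?_⟩
  rintro a b (h | h | h) -
  · obtain ⟨p, hp, g, hg⟩ := hm a b h
    exact ⟨p, List.mem_append_left _ hp, g, Or.inl hg⟩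
  · obtain ⟨p, hp, g, hg⟩ := hm b a h
    exact ⟨p, List.mem_append_left _ hp, g, Or.inr hg⟩
  · obtain ⟨p, hp, g, hg⟩ := hl _ _ h.1 trivial
    refine ⟨_, List.mem_append_right _ (List.mem_map_of_mem hp), g, ?_⟩
    obtain ⟨h1, h2, h3⟩ := h
    rcases hg with ⟨ha, hb⟩ | ⟨hb, ha⟩
    · have hadj : X.graph.Adj p.1 p.2 := (X.smul_adj_iff g).1 (by rwa [← ha, ← hb])
      rw [ha, hb, B.att_smul g _ _ hadj] at h2
      rw [ha, hb, B.att_smul g _ _ hadj.symm] at h3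
      exact Or.inl ⟨h2, h3⟩
    · have hadj : X.graph.Adj p.1 p.2 := (X.smul_adj_iff g).1 (by rw [← ha, ← hb]; exact h1.symm)
      rw [ha, hb, B.att_smul g _ _ hadj.symm] at h2
      rw [ha, hb, B.att_smul g _ _ hadj] at h3
      exact Or.inr ⟨h3, h2⟩

end Blowup

/-- The blow-up of the vertices of `X` to stars: every `p : P` is a new vertex joined to the
vertex `base p`. -/
def starBlowup (X : GTree G) (P : Type u) (psmul : G → P → P) (psmul_one : ∀ p, psmul 1 p = p)
    (psmul_mul : ∀ g h p, psmul (g * h) p = psmul g (psmul h p)) (base : P → X.V)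
    (base_smul : ∀ g p, base (psmul g p) = X.smul g (base p)) (att : X.V → X.V → X.V ⊕ P)
    (proj_att : ∀ x y, X.graph.Adj x y → Sum.elim id base (att x y) = x)
    (att_smul : ∀ g x y, X.graph.Adj x y →
      att (X.smul g x) (X.smul g y) = Sum.map (X.smul g) (psmul g) (att x y)) : Blowup X where
  V := X.V ⊕ P
  smul g := Sum.map (X.smul g) (psmul g)
  smul_one := by
    rintro (x | p)
    · exact congrArg Sum.inl (X.smul_one x)
    · exact congrArg Sum.inr (psmul_one p)
  smul_mul := by
    rintro g h (x | p)
    · exact congrArg Sum.inl (X.smul_mul g h x)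
    · exact congrArg Sum.inr (psmul_mul g h p)
  proj := Sum.elim id base
  proj_smul := by
    rintro g (x | p)
    · rfl
    · exact base_smul g p
  surj x := ⟨Sum.inl x, rfl⟩
  rel a b := ∃ p, a = Sum.inl (base p) ∧ b = Sum.inr p
  rel_ne := by
    rintro _ _ ⟨p, rfl, rfl⟩
    exact Sum.inl_ne_inr
  rel_proj := by
    rintro _ _ ⟨p, rfl, rfl⟩
    rfl
  rel_smul := by
    rintro g _ _ ⟨p, rfl, rfl⟩
    exact ⟨psmul g p, congrArg Sum.inl (base_smul g p).symm, rfl⟩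
  no_inversions := by
    rintro g _ _ ⟨p, rfl, rfl⟩ ⟨h, -⟩
    exact Sum.inl_ne_inr h
  conn := by
    have key : ∀ a : X.V ⊕ P, Relation.EqvGen
        (fun a b => ∃ p, a = Sum.inl (base p) ∧ b = Sum.inr p)
        (Sum.inl (Sum.elim id base a)) a := by
      rintro (x | p)
      · exact Relation.EqvGen.refl _
      · exact Relation.EqvGen.rel _ _ ⟨p, rfl, rfl⟩
    intro a b hab
    exact Relation.EqvGen.trans _ _ _ (Relation.EqvGen.symm _ _ (key a)) (hab ▸ key b)
  cut := by
    rintro _ _ ⟨p, rfl, rfl⟩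
    refine ⟨fun a => a = Sum.inr p, by simp, ?_⟩
    rintro _ _ ⟨p', rfl, rfl⟩ - hne
    refine iff_of_false Sum.inl_ne_inr fun h => hne ?_
    rw [Sum.inr.inj h]
  att := att
  proj_att := proj_att
  att_smul := att_smul

theorem IsGIso.isContraction {X Y : GTree G} {ι : X.V → Y.V} (h : IsGIso X Y ι) :
    IsContraction X Y ι where
  surj := h.1.2
  equivariant := h.2.2
  eqvGen u v huv := by
    rw [h.1.1 huv]
    exact Relation.EqvGen.refl _
  adj a b _ := by
    refine ⟨fun hab => ?_, ?_⟩
    · obtain ⟨u, rfl⟩ := h.1.2 a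
      obtain ⟨v, rfl⟩ := h.1.2 b
      exact ⟨u, v, (h.2.1 u v).2 hab, rfl, rfl⟩
    · rintro ⟨u, v, huv, rfl, rfl⟩
      exact (h.2.1 u v).1 huv

/-- Isomorphic trees have a common expansion. -/
theorem IsGIso.elemDeformation {X Y : GTree G} {ι : X.V → Y.V} (h : IsGIso X Y ι) :
    ElemDeformation X Y := by
  obtain ⟨v⟩ := X.isTree.connected.nonempty
  set B : Blowup X := starBlowup X {w : X.V // ∃ g, w = X.smul g v}
    (fun g p => ⟨X.smul g p.1, by
      obtain ⟨h, hh⟩ := p.2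
      exact ⟨g * h, by rw [hh, X.smul_mul]⟩⟩)
    (fun p => Subtype.ext (X.smul_one _)) (fun g h p => Subtype.ext (X.smul_mul g h _))
    Subtype.val (fun _ _ => rfl) (fun x _ => Sum.inl x) (fun _ _ _ => rfl) (fun _ _ _ _ => rfl)
    with hB
  let p : {w : X.V // ∃ g, w = X.smul g v} := ⟨v, 1, (X.smul_one v).symm⟩
  let e : B.tree.Edge := ⟨(Sum.inr p, Sum.inl v), Or.inr (Or.inl ⟨p, rfl, rfl⟩)⟩
  have key : ∀ (Z : GTree G) (κ : X.V → Z.V), IsGIso X Z κ → Collapse B.tree Z := by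
    intro Z κ hκ
    refine ⟨κ ∘ B.proj, e, ?_, fun g hg => Sum.inr_ne_inl hg, hκ.1.2.comp B.surj, ?_, ?_, ?_⟩
    · refine inf_eq_left.2 fun g hg => ?_
      change Sum.inr _ = Sum.inr _ at hg
      exact congrArg Sum.inl (congrArg Subtype.val (Sum.inr.inj hg))
    · intro g x
      exact (congrArg κ (B.proj_smul g x)).trans (hκ.2.2 g _)
    · intro a b
      refine ⟨fun hab => ?_, fun hab => ?_⟩
      · have hrel : ∀ a b, B.rel a b → Relation.EqvGen (fun a b : B.tree.V =>
            ∃ γ : G, a = B.tree.smul γ (d0 e) ∧ b = B.tree.smul γ (d1 e)) a b := by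
          rintro _ _ ⟨⟨_, g, rfl⟩, rfl, rfl⟩
          exact Relation.EqvGen.symm _ _ (Relation.EqvGen.rel _ _ ⟨g, rfl, rfl⟩)
        have := B.conn a b (hκ.1.1 hab)
        clear hab
        induction this with
        | rel a b h => exact hrel a b h
        | refl => exact Relation.EqvGen.refl _
        | symm _ _ _ ih => exact Relation.EqvGen.symm _ _ ih
        | trans _ _ _ _ _ ih ih' => exact Relation.EqvGen.trans _ _ _ ih ih'
      · induction hab with
        | rel a b h =>
          obtain ⟨g, rfl, rfl⟩ := h
          rfl
        | refl => rfl
        | symm _ _ _ ih => exact ih.symm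
        | trans _ _ _ _ _ ih ih' => exact ih.trans ih'
    · intro a b hab
      rw [hκ.isContraction.adj a b hab]
      constructor
      · rintro ⟨u, v, huv, rfl, rfl⟩
        obtain ⟨u', v', rfl, rfl, huv'⟩ := B.lift huv
        exact ⟨u', v', huv', rfl, rfl⟩
      · rintro ⟨u, v, huv, rfl, rfl⟩
        exact ⟨B.proj u, B.proj v,
          (B.cross_of_ne huv fun h => hab (congrArg κ h)).1, rfl, rfl⟩
  have hX : IsGIso X X id := ⟨Function.bijective_id, fun _ _ => Iff.rfl, fun _ _ => rfl⟩
  exact Relation.EqvGen.trans _ _ _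
    (Relation.EqvGen.symm _ _ (Relation.EqvGen.rel _ _ (key X id hX)))
    (Relation.EqvGen.rel _ _ (key Y ι h))

/-- A contraction of finitely many orbits of edges creating no new elliptic vertex stabilizers
is an elementary deformation. -/
theorem IsContraction.elemDeformation {X Y : GTree G} {q : X.V → Y.V}
    (hq : IsContraction X Y q) (hell : ∀ y, ∃ x, ∀ g, Y.smul g y = y → X.smul g x = x)
    {l : List (X.V × X.V)} (hl : EdgeCover X (fun _ _ => True) l) : ElemDeformation X Y := by
  obtain ⟨X', hX', ι, hι⟩ := IsContraction.exists_elemDeformation _ X q hq hell l rfl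
    fun u v huv _ => hl u v huv trivial
  exact Relation.EqvGen.trans _ _ _ hX' hι.elemDeformation

/-- The tree has finitely many orbits of edges. -/
def EdgeFinite (X : GTree G) : Prop := ∃ l, EdgeCover X (fun _ _ => True) l

theorem IsContraction.edgeFinite {X Y : GTree G} {q : X.V → Y.V} (hq : IsContraction X Y q)
    (hX : EdgeFinite X) : EdgeFinite Y := by
  obtain ⟨l, hl⟩ := hX
  refine ⟨l.map fun p => (q p.1, q p.2), ?_⟩
  intro a b hab _
  obtain ⟨u, v, huv, rfl, rfl⟩ := (hq.adj a b hab.ne).1 hab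
  obtain ⟨p, hp, g, hg⟩ := hl u v huv trivial
  refine ⟨_, List.mem_map_of_mem hp, g, ?_⟩
  simp only [← hq.equivariant g]
  rcases hg with ⟨rfl, rfl⟩ | ⟨rfl, rfl⟩
  · exact Or.inl ⟨rfl, rfl⟩
  · exact Or.inr ⟨rfl, rfl⟩

/-- `O` is an invariant orientation of the edges of `X`. -/
structure IsOrientation (X : GTree G) (O : X.V → X.V → Prop) : Prop where
  smul : ∀ g u v, O u v → O (X.smul g u) (X.smul g v)
  iff_not : ∀ u v, X.graph.Adj u v → (O u v ↔ ¬ O v u)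

namespace IsOrientation

variable {X : GTree G} {O : X.V → X.V → Prop}

theorem smul_iff (hO : X.IsOrientation O) (g : G) (u v : X.V) :
    O (X.smul g u) (X.smul g v) ↔ O u v := by
  refine ⟨fun h => ?_, hO.smul g u v⟩
  have := hO.smul g⁻¹ _ _ h
  rwa [inv_smul_smul, inv_smul_smul] at this

theorem flip (hO : X.IsOrientation O) : X.IsOrientation fun u v => O v u :=
  ⟨fun g u v h => hO.smul g v u h, fun u v h => hO.iff_not v u h.symm⟩

end IsOrientation

/-- An action without inversions preserves an orientation of the edges. -/
theorem exists_isOrientation (X : GTree G) : ∃ O, X.IsOrientation O := by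
  let S : Setoid (X.V × X.V) :=
    { r := fun p p' => ∃ g, p' = (X.smul g p.1, X.smul g p.2) ∨ p' = (X.smul g p.2, X.smul g p.1)
      iseqv :=
        { refl := fun p => ⟨1, Or.inl (by rw [X.smul_one, X.smul_one])⟩
          symm := by
            rintro p _ ⟨g, rfl | rfl⟩
            · exact ⟨g⁻¹, Or.inl (by simp only [inv_smul_smul])⟩
            · exact ⟨g⁻¹, Or.inr (by simp only [inv_smul_smul])⟩
          trans := by
            rintro p _ _ ⟨g, rfl | rfl⟩ ⟨h, rfl | rfl⟩ <;> refine ⟨h * g, ?_⟩ <;>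
              simp [X.smul_mul] } }
  let r : X.V → X.V → X.V × X.V := fun u v => Quotient.out (Quotient.mk S (u, v))
  have hswap : ∀ u v, r u v = r v u := fun u v =>
    congrArg Quotient.out (Quotient.sound (s := S) (a := (u, v)) (b := (v, u))
      ⟨1, Or.inr (by simp only [X.smul_one])⟩)
  have hsmul : ∀ g u v, r (X.smul g u) (X.smul g v) = r u v := fun g u v =>
    (congrArg Quotient.out (Quotient.sound (s := S) (a := (u, v))
      (b := (X.smul g u, X.smul g v)) ⟨g, Or.inl rfl⟩)).symm
  refine ⟨fun u v => ∃ g, (u, v) = (X.smul g (r u v).1, X.smul g (r u v).2), ?_, ?_⟩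
  · rintro g u v ⟨h, hh⟩
    refine ⟨g * h, ?_⟩
    rw [hsmul, X.smul_mul, X.smul_mul]
    rw [Prod.mk.injEq] at hh ⊢
    exact ⟨congrArg (X.smul g) hh.1, congrArg (X.smul g) hh.2⟩
  · intro u v huv
    simp only [hswap v u, Prod.mk.injEq]
    constructor
    · rintro ⟨g, hu, hv⟩ ⟨h, hv', hu'⟩
      refine X.no_inversions (h * g⁻¹) u v huv ⟨?_, ?_⟩
      · rw [hu, X.smul_mul, inv_smul_smul, ← hv']
      · rw [hv, X.smul_mul, inv_smul_smul, ← hu']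
    · intro hn
      obtain ⟨g, hg | hg⟩ := Quotient.mk_out (s := S) (u, v)
      · rw [Prod.mk.injEq] at hg
        exact ⟨g, hg⟩
      · rw [Prod.mk.injEq] at hg
        exact absurd ⟨g, hg.2, hg.1⟩ hn

/-- `f : X → Y` is an equivariant graph homomorphism and `s` is an equivariant section of it on
vertices. -/
structure IsSplitHom (X Y : GTree G) (f : X.V → Y.V) (s : Y.V → X.V) : Prop where
  adj : ∀ u v, X.graph.Adj u v → Y.graph.Adj (f u) (f v)
  equivariant : Equivariant f
  section_equivariant : Equivariant s
  section_eq : ∀ y, f (s y) = y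

section fold

variable {X Y : GTree G} (f : X.V → Y.V) (O : Y.V → Y.V → Prop)

/-- The classes of outgoing edges with a common origin and a common image under `f`. -/
def FoldPoint : Type u :=
  {p : X.V × Y.V // ∃ b, X.graph.Adj p.1 b ∧ O (f p.1) (f b) ∧ f b = p.2}

variable {f O}

theorem FoldPoint.exists_eq (p : FoldPoint f O) :
    ∃ (x y : X.V) (h : X.graph.Adj x y) (h' : O (f x) (f y)), p = ⟨(x, f y), y, h, h', rfl⟩ := by
  obtain ⟨⟨x, z⟩, y, h, h', e⟩ := p
  have e' : f y = z := e
  subst e'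
  exact ⟨x, y, h, h', rfl⟩

/-- The action on the classes of outgoing edges. -/
def FoldPoint.smul (hf : Equivariant f) (hO : Y.IsOrientation O) (g : G) (p : FoldPoint f O) :
    FoldPoint f O :=
  ⟨(X.smul g p.1.1, Y.smul g p.1.2), by
    obtain ⟨b, hb, hO', hfb⟩ := p.2
    refine ⟨X.smul g b, X.smul_adj g hb, ?_, ?_⟩
    · rw [hf, hf]
      exact hO.smul g _ _ hO'
    · rw [hf, hfb]⟩

open Classical in
variable (f O) in
/-- The attaching point of the edge `(x, y)`. -/
noncomputable def foldAtt (x y : X.V) : X.V ⊕ FoldPoint f O :=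
  if h : X.graph.Adj x y ∧ O (f x) (f y) then Sum.inr ⟨(x, f y), y, h.1, h.2, rfl⟩ else Sum.inl x

theorem foldAtt_pos {x y : X.V} (h : X.graph.Adj x y) (h' : O (f x) (f y)) :
    foldAtt f O x y = Sum.inr ⟨(x, f y), y, h, h', rfl⟩ := dif_pos ⟨h, h'⟩

theorem foldAtt_neg {x y : X.V} (h' : ¬ O (f x) (f y)) : foldAtt f O x y = Sum.inl x :=
  dif_neg fun h => h' h.2

/-- The first half of a fold: outgoing edges with a common origin and a common image are grouped
together. -/
noncomputable def foldBlowup (hf : Equivariant f) (hO : Y.IsOrientation O) : Blowup X :=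
  starBlowup X (FoldPoint f O) (FoldPoint.smul hf hO)
    (fun p => Subtype.ext (Prod.ext (X.smul_one _) (Y.smul_one _)))
    (fun g h p => Subtype.ext (Prod.ext (X.smul_mul g h _) (Y.smul_mul g h _)))
    (fun p => p.1.1) (fun _ _ => rfl) (foldAtt f O)
    (fun x y _ => by unfold foldAtt; split_ifs <;> rfl)
    (fun g x y hxy => by
      by_cases h : O (f x) (f y)
      · have h' : O (f (X.smul g x)) (f (X.smul g y)) := by
          rw [hf, hf]
          exact hO.smul g _ _ h
        rw [foldAtt_pos hxy h, foldAtt_pos (X.smul_adj g hxy) h']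
        refine congrArg Sum.inr (Subtype.ext (Prod.ext rfl (hf g y)))
      · have h' : ¬ O (f (X.smul g x)) (f (X.smul g y)) := by
          rwa [hf, hf, hO.smul_iff]
        rw [foldAtt_neg h, foldAtt_neg h']
        rfl)

theorem foldBlowup_edgeFinite (hf : Equivariant f) (hO : Y.IsOrientation O) (hX : EdgeFinite X) :
    EdgeFinite (foldBlowup hf hO).tree := by
  obtain ⟨l, hl⟩ := hX
  refine (foldBlowup hf hO).exists_edgeCover hl
    (m := l.flatMap fun q => [(Sum.inl q.1, foldAtt f O q.1 q.2),
      (Sum.inl q.2, foldAtt f O q.2 q.1)]) ?_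
  rintro _ _ ⟨p, rfl, rfl⟩
  obtain ⟨x, y, hxy, hxy', rfl⟩ := p.exists_eq
  have key : ∀ x' y' g, x = X.smul g x' → y = X.smul g y' →
      Sum.inr ⟨(x, f y), y, hxy, hxy', rfl⟩ = (foldBlowup hf hO).smul g (foldAtt f O x' y') := by
    rintro x' y' g rfl rfl
    rw [← foldAtt_pos hxy hxy']
    exact (foldBlowup hf hO).att_smul g x' y' ((X.smul_adj_iff g).1 hxy)
  obtain ⟨p, hp, g, ⟨h1, h2⟩ | ⟨h1, h2⟩⟩ := hl x y hxy trivial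
  · exact ⟨_, List.mem_flatMap.2 ⟨p, hp, List.mem_cons_self⟩, g, congrArg Sum.inl h1,
      key _ _ g h1 h2⟩
  · exact ⟨_, List.mem_flatMap.2 ⟨p, hp, List.mem_cons_of_mem _ List.mem_cons_self⟩, g,
      congrArg Sum.inl h2, key _ _ g h2 h1⟩

variable (f O) in
/-- The relation contracted in the second half of a fold. -/
def foldRel (a b : X.V ⊕ FoldPoint f O) : Prop :=
  ∃ (x y : X.V) (h : X.graph.Adj x y) (h' : O (f x) (f y)),
    a = Sum.inr ⟨(x, f y), y, h, h', rfl⟩ ∧ b = Sum.inl y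

theorem adj_of_foldRel (hf : Equivariant f) (hfa : ∀ u v, X.graph.Adj u v → Y.graph.Adj (f u) (f v))
    (hO : Y.IsOrientation O) (a b : (foldBlowup hf hO).tree.V) (h : foldRel f O a b) :
    (foldBlowup hf hO).tree.graph.Adj a b := by
  obtain ⟨x, y, h, h', rfl, rfl⟩ := h
  have := (foldBlowup hf hO).cross_att h
  change (foldBlowup hf hO).Cross (foldAtt f O x y) (foldAtt f O y x) at this
  rw [foldAtt_pos h h', foldAtt_neg ((hO.iff_not _ _ (hfa _ _ h)).1 h')] at this
  exact Or.inr (Or.inr this)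

theorem foldRel_smul (hf : Equivariant f) (hO : Y.IsOrientation O) (g : G)
    (a b : (foldBlowup hf hO).tree.V) (h : foldRel f O a b) :
    foldRel f O ((foldBlowup hf hO).tree.smul g a) ((foldBlowup hf hO).tree.smul g b) := by
  obtain ⟨x, y, h, h', rfl, rfl⟩ := h
  refine ⟨X.smul g x, X.smul g y, X.smul_adj g h, ?_, ?_, rfl⟩
  · rw [hf, hf]
    exact hO.smul g _ _ h'
  · exact congrArg Sum.inr (Subtype.ext (Prod.ext rfl (hf g y).symm))

/-- Identifying the outgoing edges with a common origin and a common image is an elementary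
deformation. -/
theorem IsSplitHom.exists_fold {s : Y.V → X.V} (h : IsSplitHom X Y f s) (hX : EdgeFinite X)
    (hO : Y.IsOrientation O) :
    ∃ (X' : GTree G) (p : X.V → X'.V) (f' : X'.V → Y.V),
      ElemDeformation X X' ∧ EdgeFinite X' ∧ Function.Surjective p ∧
      (∀ u v, X.graph.Adj u v → X'.graph.Adj (p u) (p v)) ∧ (∀ x, f' (p x) = f x) ∧
      IsSplitHom X' Y f' (fun y => p (s y)) ∧
      ∀ v b b', X.graph.Adj v b → X.graph.Adj v b' → O (f v) (f b) → f b = f b' → p b = p b' := by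
  have hf := h.equivariant
  set B := foldBlowup hf hO with hB
  have hF := adj_of_foldRel hf h.adj hO
  have hG := foldRel_smul hf hO
  let q := contractMap hF hG
  let F : B.tree.V → Y.V := Sum.elim f fun p => p.1.2
  have hFF : ∀ a b, foldRel f O a b → F a = F b := by
    rintro _ _ ⟨x, y, h, h', rfl, rfl⟩
    rfl
  let f' : (B.tree.contract _ hF hG).V → Y.V := Quot.lift F hFF
  have hqe : ∀ x y (h : X.graph.Adj x y) (h' : O (f x) (f y)),
      q (Sum.inr ⟨(x, f y), y, h, h', rfl⟩) = q (Sum.inl y) :=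
    fun x y h h' => Quot.sound ⟨x, y, h, h', rfl, rfl⟩
  have hqa : ∀ x y (h : X.graph.Adj x y), O (f x) (f y) →
      (B.tree.contract _ hF hG).graph.Adj (q (Sum.inl x)) (q (Sum.inl y)) := by
    intro x y hxy hxy'
    refine ⟨fun he => (h.adj x y hxy).ne (congrArg f' he), Sum.inl x, _,
      Or.inl ⟨⟨(x, f y), y, hxy, hxy', rfl⟩, rfl, rfl⟩, rfl, hqe x y hxy hxy'⟩
  have hfin : EdgeFinite B.tree := foldBlowup_edgeFinite hf hO hX
  have hBX := B.isContraction
  have hc := contractMap_isContraction hF hG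
  have hf' : Equivariant f' := by
    rintro g ⟨x | p⟩
    · exact hf g x
    · rfl
  have hs : Equivariant fun y => q (Sum.inl (s y)) := fun g y =>
    congrArg (fun z => q (Sum.inl z)) (h.section_equivariant g y)
  refine ⟨B.tree.contract _ hF hG, fun x => q (Sum.inl x), f', ?_, hc.edgeFinite hfin, ?_, ?_,
    fun _ => rfl, ⟨?_, hf', hs, h.section_eq⟩, ?_⟩
  · obtain ⟨l, hl⟩ := hfin
    refine Relation.EqvGen.trans _ _ _ (Relation.EqvGen.symm _ _ (hBX.elemDeformation ?_ hl))
      (hc.elemDeformation ?_ hl)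
    · exact fun x => ⟨Sum.inl x, fun g hg => congrArg Sum.inl hg⟩
    · refine fun z => ⟨Sum.inl (s (f' z)), fun g hg => congrArg Sum.inl ?_⟩
      rw [← h.section_equivariant, ← hf', hg]
  · rintro ⟨x | p⟩
    · exact ⟨x, rfl⟩
    · obtain ⟨x, y, hxy, hxy', rfl⟩ := p.exists_eq
      exact ⟨y, (hqe x y hxy hxy').symm⟩
  · intro u v huv
    by_cases hO' : O (f u) (f v)
    · exact hqa u v huv hO'
    · exact (hqa v u huv.symm ((hO.flip.iff_not _ _ (h.adj _ _ huv)).2 hO')).symm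
  · rintro _ _ ⟨hne, a, b, hab, rfl, rfl⟩
    have hrel : ∀ a b, B.rel a b → Y.graph.Adj (F a) (F b) := by
      rintro _ _ ⟨p, rfl, rfl⟩
      obtain ⟨x, y, hxy, hxy', rfl⟩ := p.exists_eq
      exact h.adj x y hxy
    have hcross : ∀ x y, X.graph.Adj x y → O (f x) (f y) →
        foldRel f O (foldAtt f O x y) (foldAtt f O y x) := by
      intro x y hxy hxy'
      rw [foldAtt_pos hxy hxy', foldAtt_neg ((hO.iff_not _ _ (h.adj _ _ hxy)).1 hxy')]
      exact ⟨x, y, hxy, hxy', rfl, rfl⟩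
    rcases hab with hab | hab | ⟨hab, ha, hb⟩
    · exact hrel a b hab
    · exact (hrel b a hab).symm
    · refine absurd ?_ hne
      change q a = q b
      by_cases hO' : O (f (B.proj a)) (f (B.proj b))
      · exact (congrArg q ha).trans
          ((Quot.sound (hcross _ _ hab hO')).trans (congrArg q hb.symm))
      · exact (congrArg q ha).trans ((Quot.sound (hcross _ _ hab.symm
          ((hO.flip.iff_not _ _ (h.adj _ _ hab)).2 hO'))).symm.trans (congrArg q hb.symm))
  · intro v b b' hb hb' hO' he
    refine (hqe v b hb hO').symm.trans (Eq.trans ?_ (hqe v b' hb' (he ▸ hO')))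
    exact congrArg (fun z => q (Sum.inr z)) (Subtype.ext (Prod.ext rfl he))

end fold

/-- Identifying the edges with a common origin and a common image is an elementary deformation. -/
theorem IsSplitHom.exists_full_fold {X Y : GTree G} {f : X.V → Y.V} {s : Y.V → X.V}
    (h : IsSplitHom X Y f s) (hX : EdgeFinite X) :
    ∃ (X' : GTree G) (p : X.V → X'.V) (f' : X'.V → Y.V),
      ElemDeformation X X' ∧ EdgeFinite X' ∧ Function.Surjective p ∧
      (∀ u v, X.graph.Adj u v → X'.graph.Adj (p u) (p v)) ∧ (∀ x, f' (p x) = f x) ∧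
      IsSplitHom X' Y f' (fun y => p (s y)) ∧
      ∀ v b b', X.graph.Adj v b → X.graph.Adj v b' → f b = f b' → p b = p b' := by
  obtain ⟨O, hO⟩ := Y.exists_isOrientation
  obtain ⟨X₁, p₁, f₁, hd₁, hX₁, hp₁, ha₁, hf₁, h₁, hfold₁⟩ := h.exists_fold hX hO
  obtain ⟨X₂, p₂, f₂, hd₂, hX₂, hp₂, ha₂, hf₂, h₂, hfold₂⟩ := h₁.exists_fold hX₁ hO.flip
  refine ⟨X₂, fun x => p₂ (p₁ x), f₂, Relation.EqvGen.trans _ _ _ hd₁ hd₂, hX₂, hp₂.comp hp₁,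
    fun u v huv => ha₂ _ _ (ha₁ _ _ huv), fun x => by rw [hf₂, hf₁], h₂, ?_⟩
  intro v b b' hb hb' he
  by_cases hO' : O (f v) (f b)
  · exact congrArg p₂ (hfold₁ v b b' hb hb' hO' he)
  · refine hfold₂ (p₁ v) _ _ (ha₁ _ _ hb) (ha₁ _ _ hb') ?_ (by rw [hf₁, hf₁, he])
    rw [hf₁, hf₁]
    exact (hO.flip.iff_not _ _ (h.adj _ _ hb)).2 hO'

theorem IsSplitHom.isGIso {X Y : GTree G} {f : X.V → Y.V} {s : Y.V → X.V}
    (h : IsSplitHom X Y f s) (hinj : Function.Injective f) : IsGIso X Y f := by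
  refine ⟨⟨hinj, fun y => ⟨s y, h.section_eq y⟩⟩, fun x x' => ⟨h.adj x x', fun hadj => ?_⟩,
    h.equivariant⟩
  obtain ⟨w, hw⟩ := X.isTree.connected.exists_isPath x x'
  have hw' := Walk.IsPath.map (f := (⟨f, fun h' => h.adj _ _ h'⟩ : X.graph →g Y.graph)) hinj hw
  have he := congrArg Walk.length
    ((Y.isTree.existsUnique_path (f x) (f x')).unique hw' (Walk.IsPath.of_adj hadj))
  rw [Walk.length_map] at he
  exact Walk.adj_of_length_eq_one he

/-- A split homomorphism from an edge-finite tree whose fibers have bounded diameter is an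
elementary deformation. -/
theorem IsSplitHom.elemDeformation {Y : GTree G} (n : ℕ) :
    ∀ {X : GTree G} {f : X.V → Y.V} {s : Y.V → X.V}, IsSplitHom X Y f s → EdgeFinite X →
      (∀ x x', f x = f x' → X.graph.dist x x' ≤ n) → ElemDeformation X Y := by
  induction n with
  | zero =>
    intro X f s h _ hd
    refine (h.isGIso fun x x' hxx => ?_).elemDeformation
    exact (X.isTree.connected.dist_eq_zero_iff).1 (Nat.le_zero.1 (hd x x' hxx))
  | succ n ih =>
    intro X f s h hX hd
    obtain ⟨X', p, f', hd', hX', hp, ha, hf, h', hfold⟩ := h.exists_full_fold hX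
    refine Relation.EqvGen.trans _ _ _ hd' (ih h' hX' ?_)
    intro z z' hzz
    obtain ⟨x, rfl⟩ := hp z
    obtain ⟨x', rfl⟩ := hp z'
    rw [hf, hf] at hzz
    obtain ⟨w, hw⟩ := X.isTree.connected.exists_walk_length_eq_dist x x'
    have hle := hd x x' hzz
    have hmap := X.isTree.connected.dist_map_le ha
    by_cases h0 : w.length = 0
    · rw [Walk.eq_of_length_eq_zero h0, dist_self]
      exact Nat.zero_le n
    obtain ⟨i, hi, hfi⟩ := Walk.exists_backtrack Y.isTree f h.adj w h0 hzz
    have hpi : p (w.getVert i) = p (w.getVert (i + 2)) :=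
      hfold (w.getVert (i + 1)) _ _ (w.adj_getVert_succ (by omega)).symm
        (w.adj_getVert_succ (by omega)) hfi
    have h1 := (hmap x (w.getVert i)).trans (dist_le (w.take i))
    have h2 := (hmap (w.getVert (i + 2)) x').trans (dist_le (w.drop (i + 2)))
    have h3 := X'.isTree.connected.dist_triangle (u := p x) (v := p (w.getVert i)) (w := p x')
    rw [hpi] at h3 h1
    rw [Walk.drop_length] at h2
    have := Walk.take_length w i
    omega

/-- The tree has finitely many orbits of vertices. -/
def VertexFinite (X : GTree G) : Prop := ∃ l : List X.V, ∀ x, ∃ x₀ ∈ l, ∃ g, x = X.smul g x₀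

theorem exists_list_subtype {α : Type*} {P : α → Prop} (l : List α) :
    ∃ l' : List {a // P a}, ∀ a : {a // P a}, a.1 ∈ l → a ∈ l' := by
  induction l with
  | nil => exact ⟨[], fun a ha => absurd ha List.not_mem_nil⟩
  | cons b l ih =>
    obtain ⟨l', hl'⟩ := ih
    by_cases hb : P b
    · refine ⟨⟨b, hb⟩ :: l', fun a ha => ?_⟩
      rcases List.mem_cons.1 ha with h | h
      · exact List.mem_cons.2 (Or.inl (Subtype.ext h))
      · exact List.mem_cons.2 (Or.inr (hl' a h))
    · refine ⟨l', fun a ha => ?_⟩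
      rcases List.mem_cons.1 ha with h | h
      · exact absurd (h ▸ a.2) hb
      · exact hl' a h

section segments

variable {X Y : GTree G} (φ : X.V → Y.V) (ψ : Y.V → X.V) (O : X.V → X.V → Prop)

/-- The points of `Y` spanning, together with `φ x`, the subtree by which `x` is replaced. -/
def IsTarget (x : X.V) (t : Y.V) : Prop :=
  t = φ x ∨ (∃ x', X.graph.Adj x x' ∧ O x x' ∧ t = φ x') ∨ x = ψ t

/-- The vertex `y` is on a segment from `φ x` to a target of `x`. -/
def IsSegPoint (x : X.V) (y : Y.V) : Prop :=
  ∃ t, IsTarget φ ψ O x t ∧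
    Y.graph.dist (φ x) y + Y.graph.dist y t = Y.graph.dist (φ x) t

variable {φ ψ O}

theorem IsTarget.isSegPoint {x : X.V} {t : Y.V} (h : IsTarget φ ψ O x t) :
    IsSegPoint φ ψ O x t := ⟨t, h, by rw [dist_self, add_zero]⟩

theorem IsTarget.smul (hφ : Equivariant φ) (hψ : Equivariant ψ) (hO : X.IsOrientation O) (g : G)
    {x : X.V} {t : Y.V} (h : IsTarget φ ψ O x t) :
    IsTarget φ ψ O (X.smul g x) (Y.smul g t) := by
  rcases h with rfl | ⟨x', h, h', rfl⟩ | rfl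
  · exact Or.inl (hφ g x).symm
  · exact Or.inr (Or.inl ⟨X.smul g x', X.smul_adj g h, hO.smul g _ _ h', (hφ g x').symm⟩)
  · exact Or.inr (Or.inr (hψ g t).symm)

theorem IsSegPoint.smul (hφ : Equivariant φ) (hψ : Equivariant ψ) (hO : X.IsOrientation O) (g : G)
    {x : X.V} {y : Y.V} (h : IsSegPoint φ ψ O x y) :
    IsSegPoint φ ψ O (X.smul g x) (Y.smul g y) := by
  obtain ⟨t, ht, hd⟩ := h
  refine ⟨Y.smul g t, ht.smul hφ hψ hO g, ?_⟩
  rw [hφ, dist_smul, dist_smul, dist_smul, hd]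

theorem IsSegPoint.of_adj {x : X.V} {y n : Y.V} (h : IsSegPoint φ ψ O x y)
    (hn : Y.graph.Adj y n) (hd : Y.graph.dist n (φ x) < Y.graph.dist y (φ x)) :
    IsSegPoint φ ψ O x n := by
  obtain ⟨t, ht, ht'⟩ := h
  refine ⟨t, ht, ?_⟩
  have h1 := Y.isTree.connected.dist_triangle (u := φ x) (v := n) (w := t)
  have h2 := Y.isTree.connected.dist_triangle (u := n) (v := y) (w := t)
  rw [dist_comm, dist_comm (u := y) (v := φ x)] at hd
  rw [dist_eq_one_iff_adj.2 hn.symm] at h2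
  omega

variable (φ ψ O) in
/-- The vertices of the blow-up of `X` along segments of `Y`. -/
def SegPoint : Type u := {p : X.V × Y.V // IsSegPoint φ ψ O p.1 p.2}

variable (φ ψ O) in
/-- The base point of the subtree replacing `x`. -/
def SegPoint.base (x : X.V) : SegPoint φ ψ O := ⟨(x, φ x), IsTarget.isSegPoint (Or.inl rfl)⟩

theorem SegPoint.eqvGen_base (a : SegPoint φ ψ O) :
    Relation.EqvGen (fun p q : SegPoint φ ψ O => p.1.1 = q.1.1 ∧ Y.graph.Adj p.1.2 q.1.2) a
      (SegPoint.base φ ψ O a.1.1) := by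
  obtain ⟨n, hn⟩ : ∃ n, n = Y.graph.dist a.1.2 (φ a.1.1) := ⟨_, rfl⟩
  induction n using Nat.strong_induction_on generalizing a with
  | _ n ih =>
    by_cases he : a.1.2 = φ a.1.1
    · have : a = SegPoint.base φ ψ O a.1.1 := Subtype.ext (Prod.ext rfl he)
      rw [← this]
      exact Relation.EqvGen.refl _
    · obtain ⟨m, hm, hd⟩ := Y.isTree.connected.exists_adj_dist_lt he
      let b : SegPoint φ ψ O := ⟨(a.1.1, m), a.2.of_adj hm hd⟩
      exact Relation.EqvGen.trans _ b _ (Relation.EqvGen.rel _ _ ⟨rfl, hm⟩)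
        (ih _ (hn ▸ hd) b rfl)

open Classical in
variable (φ ψ O) in
/-- The attaching point of the edge `(x, y)`. -/
noncomputable def segAtt (x y : X.V) : SegPoint φ ψ O :=
  if h : X.graph.Adj x y ∧ O x y then
    ⟨(x, φ y), IsTarget.isSegPoint (Or.inr (Or.inl ⟨y, h.1, h.2, rfl⟩))⟩
  else SegPoint.base φ ψ O x

theorem segAtt_pos {x y : X.V} (h : X.graph.Adj x y) (h' : O x y) :
    segAtt φ ψ O x y =
      ⟨(x, φ y), IsTarget.isSegPoint (Or.inr (Or.inl ⟨y, h, h', rfl⟩))⟩ := dif_pos ⟨h, h'⟩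

theorem segAtt_neg {x y : X.V} (h' : ¬(X.graph.Adj x y ∧ O x y)) :
    segAtt φ ψ O x y = SegPoint.base φ ψ O x := dif_neg h'

theorem segAtt_fst (x y : X.V) : (segAtt φ ψ O x y).1.1 = x := by
  by_cases h : X.graph.Adj x y ∧ O x y
  · exact congrArg (fun p : SegPoint φ ψ O => p.1.1) (segAtt_pos h.1 h.2)
  · exact congrArg (fun p : SegPoint φ ψ O => p.1.1) (segAtt_neg h)

theorem segAtt_snd_pos {x y : X.V} (h : X.graph.Adj x y) (h' : O x y) :
    (segAtt φ ψ O x y).1.2 = φ y := congrArg (fun p : SegPoint φ ψ O => p.1.2) (segAtt_pos h h')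

theorem segAtt_snd_neg {x y : X.V} (h' : ¬ O x y) : (segAtt φ ψ O x y).1.2 = φ x :=
  congrArg (fun p : SegPoint φ ψ O => p.1.2) (segAtt_neg fun h => h' h.2)

/-- The blow-up of `X` replacing each vertex by a subtree of `Y`, in such a way that the endpoints
of the edges of `X` are attached to points over the same point of `Y`. -/
noncomputable def segBlowup (hφ : Equivariant φ) (hψ : Equivariant ψ) (hO : X.IsOrientation O) :
    Blowup X where
  V := SegPoint φ ψ O
  smul g p := ⟨(X.smul g p.1.1, Y.smul g p.1.2), p.2.smul hφ hψ hO g⟩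
  smul_one p := Subtype.ext (Prod.ext (X.smul_one _) (Y.smul_one _))
  smul_mul g h p := Subtype.ext (Prod.ext (X.smul_mul g h _) (Y.smul_mul g h _))
  proj p := p.1.1
  proj_smul _ _ := rfl
  surj x := ⟨SegPoint.base φ ψ O x, rfl⟩
  rel p q := p.1.1 = q.1.1 ∧ Y.graph.Adj p.1.2 q.1.2
  rel_ne p q h he := h.2.ne (congrArg (fun r => r.1.2) he)
  rel_proj _ _ h := h.1
  rel_smul g p q h := ⟨congrArg (X.smul g) h.1, Y.smul_adj g h.2⟩
  no_inversions g p q h hpq := Y.no_inversions g _ _ h.2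
    ⟨congrArg (fun r => r.1.2) hpq.1, congrArg (fun r => r.1.2) hpq.2⟩
  conn a b h := by
    have hb := b.eqvGen_base
    rw [← h] at hb
    exact Relation.EqvGen.trans _ _ _ a.eqvGen_base (Relation.EqvGen.symm _ _ hb)
  cut a b hab := by
    obtain ⟨c, hc, hcut⟩ := Y.isTree.isAcyclic.exists_cut hab.2
    refine ⟨fun p => c p.1.2, hc, fun u v huv hu hne => hcut _ _ huv.2 fun hs => hne ?_⟩
    rw [Sym2.eq_iff] at hs ⊢
    rcases hs with ⟨h1, h2⟩ | ⟨h1, h2⟩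
    · exact Or.inl ⟨Subtype.ext (Prod.ext hu h1),
        Subtype.ext (Prod.ext (huv.1.symm.trans (hu.trans hab.1)) h2)⟩
    · exact Or.inr ⟨Subtype.ext (Prod.ext (hu.trans hab.1) h1),
        Subtype.ext (Prod.ext (huv.1.symm.trans hu) h2)⟩
  att := segAtt φ ψ O
  proj_att x y _ := segAtt_fst x y
  att_smul g x y h := by
    refine Subtype.ext (Prod.ext ?_ ?_)
    · change (segAtt _ _ _ _ _).1.1 = X.smul g (segAtt _ _ _ _ _).1.1
      rw [segAtt_fst, segAtt_fst]
    · change (segAtt _ _ _ _ _).1.2 = Y.smul g (segAtt _ _ _ _ _).1.2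
      by_cases h' : O x y
      · rw [segAtt_snd_pos h h', segAtt_snd_pos (X.smul_adj g h) (hO.smul g _ _ h'), hφ]
      · rw [segAtt_snd_neg h', segAtt_snd_neg (by rwa [hO.smul_iff]), hφ]

theorem SegPoint.vertexFinite (hφ : Equivariant φ) (hψ : Equivariant ψ) (hO : X.IsOrientation O)
    (hX : EdgeFinite X) (hXv : VertexFinite X) (hYv : VertexFinite Y) :
    VertexFinite (segBlowup hφ hψ hO).tree := by
  obtain ⟨l, hl⟩ := hX
  obtain ⟨lX, hlX⟩ := hXv
  obtain ⟨lY, hlY⟩ := hYv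
  let L : List (X.V × Y.V) := (lX.map fun x => (x, φ x)) ++
    ((l.map fun p => (p.1, φ p.2)) ++ ((l.map fun p => (p.2, φ p.1)) ++
      lY.map fun y => (ψ y, y)))
  have hL : ∀ x t, IsTarget φ ψ O x t → ∃ p ∈ L, ∃ g, x = X.smul g p.1 ∧ t = Y.smul g p.2 := by
    rintro x t (rfl | ⟨x', h, -, rfl⟩ | rfl)
    · obtain ⟨x₀, hx₀, g, rfl⟩ := hlX x
      exact ⟨_, List.mem_append_left _ (List.mem_map_of_mem hx₀), g, rfl, hφ g x₀⟩
    · obtain ⟨p, hp, g, ⟨rfl, rfl⟩ | ⟨rfl, rfl⟩⟩ := hl x x' h trivial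
      · exact ⟨_, List.mem_append_right _ (List.mem_append_left _ (List.mem_map_of_mem hp)), g,
          rfl, hφ g _⟩
      · exact ⟨_, List.mem_append_right _ (List.mem_append_right _ (List.mem_append_left _
          (List.mem_map_of_mem hp))), g, rfl, hφ g _⟩
    · obtain ⟨y, hy, g, rfl⟩ := hlY t
      exact ⟨_, List.mem_append_right _ (List.mem_append_right _ (List.mem_append_right _
          (List.mem_map_of_mem hy))), g, hψ g y, rfl⟩
  choose w hw using fun p : X.V × Y.V => Y.isTree.connected.exists_isPath (φ p.1) p.2
  obtain ⟨l', hl'⟩ := exists_list_subtype (P := fun p : X.V × Y.V => IsSegPoint φ ψ O p.1 p.2)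
    (L.flatMap fun p => (w p).support.map fun y => (p.1, y))
  refine ⟨l', ?_⟩
  rintro ⟨⟨x, y⟩, t, ht, hd⟩
  obtain ⟨p, hp, g, hx, rfl⟩ := hL x t ht
  have hx' : x = X.smul g p.1 := hx
  subst hx'
  change Y.graph.dist (φ (X.smul g p.1)) y + _ = _ at hd
  obtain ⟨y, rfl⟩ : ∃ y₀, y = Y.smul g y₀ := ⟨Y.smul g⁻¹ y, (Y.smul_inv_smul g y).symm⟩
  have ht' : IsTarget φ ψ O p.1 p.2 := by
    have := ht.smul hφ hψ hO g⁻¹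
    rwa [inv_smul_smul, inv_smul_smul] at this
  rw [hφ, dist_smul, dist_smul, dist_smul] at hd
  refine ⟨⟨(p.1, y), p.2, ht', hd⟩, hl' _ ?_, g, rfl⟩
  exact List.mem_flatMap.2 ⟨p, hp, List.mem_map_of_mem
    (Y.isTree.mem_support_of_dist_add_dist hd (hw p))⟩

theorem segBlowup_edgeFinite (hφ : Equivariant φ) (hψ : Equivariant ψ) (hO : X.IsOrientation O)
    (hX : EdgeFinite X) (hXv : VertexFinite X) (hYv : VertexFinite Y) :
    EdgeFinite (segBlowup hφ hψ hO).tree := by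
  obtain ⟨L, hL⟩ := SegPoint.vertexFinite hφ hψ hO hX hXv hYv
  let B := segBlowup hφ hψ hO
  have hnext : ∀ q : SegPoint φ ψ O, ∃ q', ∀ b : SegPoint φ ψ O, B.rel q b →
      Y.graph.dist b.1.2 (φ q.1.1) < Y.graph.dist q.1.2 (φ q.1.1) → b = q' := by
    intro q
    by_cases h : ∃ b : SegPoint φ ψ O, B.rel q b ∧
      Y.graph.dist b.1.2 (φ q.1.1) < Y.graph.dist q.1.2 (φ q.1.1)
    · obtain ⟨b, hb, hd⟩ := h
      exact ⟨b, fun b' hb' hd' => Subtype.ext (Prod.ext (hb'.1.symm.trans hb.1)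
        (Y.isTree.eq_of_adj_of_dist_lt hb'.2 hd' hb.2 hd))⟩
    · exact ⟨q, fun b hb hd => absurd ⟨b, hb, hd⟩ h⟩
  choose next hnext using hnext
  have key : ∀ a b : SegPoint φ ψ O, B.rel a b →
      Y.graph.dist b.1.2 (φ a.1.1) < Y.graph.dist a.1.2 (φ a.1.1) →
      ∃ q ∈ L, ∃ g, a = B.smul g q ∧ b = B.smul g (next q) := by
    intro a b hab hd
    obtain ⟨q, hq, g, rfl⟩ := hL a
    obtain ⟨b, rfl⟩ : ∃ b₀, b = B.smul g b₀ := ⟨B.tree.smul g⁻¹ b, (B.tree.smul_inv_smul g b).symm⟩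
    refine ⟨q, hq, g, rfl, congrArg (B.smul g) (hnext q b ⟨X.smul_injective g hab.1,
      (Y.smul_adj_iff g).1 hab.2⟩ ?_)⟩
    change Y.graph.dist (Y.smul g b.1.2) (φ (X.smul g q.1.1)) <
      Y.graph.dist (Y.smul g q.1.2) (φ (X.smul g q.1.1)) at hd
    rwa [hφ, dist_smul, dist_smul] at hd
  obtain ⟨l, hl⟩ := hX
  refine B.exists_edgeCover hl (m := L.flatMap fun q => [(q, next q), (next q, q)]) ?_
  intro a b hab
  have hne := Y.isTree.dist_ne_of_adj (φ a.1.1) hab.2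
  rw [SimpleGraph.dist_comm, SimpleGraph.dist_comm (v := b.1.2)] at hne
  rcases lt_or_gt_of_ne hne with hlt | hlt
  · have hba : B.rel b a := ⟨hab.1.symm, hab.2.symm⟩
    obtain ⟨q, hq, g, hb, ha⟩ := key b a hba (by rwa [← show a.1.1 = b.1.1 from hab.1])
    exact ⟨_, List.mem_flatMap.2 ⟨q, hq, List.mem_cons_of_mem _ List.mem_cons_self⟩, g, ha, hb⟩
  · obtain ⟨q, hq, g, ha, hb⟩ := key a b hab hlt
    exact ⟨_, List.mem_flatMap.2 ⟨q, hq, List.mem_cons_self⟩, g, ha, hb⟩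

end segments

/-- Equivariant maps in both directions yield, up to an elementary deformation, a split
homomorphism with bounded fibers. -/
theorem elemDeformation_of_equivariant {X Y : GTree G} {φ : X.V → Y.V} {ψ : Y.V → X.V}
    (hφ : Equivariant φ) (hψ : Equivariant ψ) (hX : EdgeFinite X) (hXv : VertexFinite X)
    (hYv : VertexFinite Y) : ElemDeformation X Y := by
  obtain ⟨O, hO⟩ := X.exists_isOrientation
  have hfin := segBlowup_edgeFinite hφ hψ hO hX hXv hYv
  have hvfin := SegPoint.vertexFinite hφ hψ hO hX hXv hYv
  let B := segBlowup hφ hψ hO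
  let F : B.tree.V → B.tree.V → Prop := B.Cross
  have hF : ∀ a b, F a b → B.tree.graph.Adj a b := fun a b h => Or.inr (Or.inr h)
  have hG : ∀ g a b, F a b → F (B.tree.smul g a) (B.tree.smul g b) :=
    fun g a b h => B.cross_smul g h
  let Z := B.tree.contract F hF hG
  let q : B.tree.V → Z.V := contractMap hF hG
  have hc : IsContraction B.tree Z q := contractMap_isContraction hF hG
  let p2 : SegPoint φ ψ O → Y.V := fun p => p.1.2
  have hp2 : ∀ x x', X.graph.Adj x x' → O x x' →
      p2 (segAtt φ ψ O x x') = p2 (segAtt φ ψ O x' x) := by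
    intro x x' h h'
    exact (segAtt_snd_pos h h').trans (segAtt_snd_neg ((hO.iff_not _ _ h).1 h')).symm
  have hFp : ∀ a b, F a b → p2 a = p2 b := by
    rintro a b ⟨h, ha, hb⟩
    refine (congrArg p2 ha).trans (Eq.trans ?_ (congrArg p2 hb).symm)
    by_cases h' : O (B.proj a) (B.proj b)
    · exact hp2 _ _ h h'
    · exact (hp2 _ _ h.symm ((hO.flip.iff_not _ _ h).2 h')).symm
  let f : Z.V → Y.V := Quot.lift p2 hFp
  have hf : Equivariant f := by
    rintro g ⟨a⟩
    rfl
  let s₀ : Y.V → B.tree.V := fun y =>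
    ⟨(ψ y, y), IsTarget.isSegPoint (Or.inr (Or.inr rfl))⟩
  have hs₀ : ∀ g y, s₀ (Y.smul g y) = B.tree.smul g (s₀ y) := fun g y =>
    Subtype.ext (Prod.ext (hψ g y) rfl)
  have hsplit : IsSplitHom Z Y f fun y => q (s₀ y) := by
    refine ⟨?_, hf, fun g y => congrArg q (hs₀ g y), fun _ => rfl⟩
    rintro _ _ ⟨hne, a, b, hab | hab | hab, rfl, rfl⟩
    · exact hab.2
    · exact hab.2.symm
    · exact absurd (Quot.sound hab) hne
  have hX₀ : ElemDeformation X Z := by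
    obtain ⟨l, hl⟩ := hfin
    refine Relation.EqvGen.trans _ _ _
      (Relation.EqvGen.symm _ _ (B.isContraction.elemDeformation ?_ hl))
      (hc.elemDeformation ?_ hl)
    · refine fun x => ⟨SegPoint.base φ ψ O x, fun g hg =>
        Subtype.ext (Prod.ext hg ?_)⟩
      change Y.smul g (φ x) = φ x
      rw [← hφ, hg]
    · refine fun z => ⟨s₀ (f z), fun g hg => ?_⟩
      rw [← hs₀, ← hf, hg]
  obtain ⟨L, hL⟩ := hvfin
  let d : Z.V → ℕ := fun u => Z.graph.dist u (q (s₀ (f u)))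
  have hd : ∀ g u, d (Z.smul g u) = d u := by
    intro g u
    change Z.graph.dist _ (q (s₀ (f (Z.smul g u)))) = _
    rw [hf, hs₀]
    exact Z.dist_smul g u (q (s₀ (f u)))
  have hbound : ∀ u, d u ≤ (L.map fun a => d (q a)).sum := by
    intro u
    obtain ⟨a, rfl⟩ := hc.surj u
    obtain ⟨a, ha, g, rfl⟩ := hL a
    rw [hc.equivariant, hd]
    exact List.single_le_sum (fun _ _ => Nat.zero_le _) _
      (List.mem_map_of_mem (f := fun a => d (q a)) ha)
  refine Relation.EqvGen.trans _ _ _ hX₀ (hsplit.elemDeformation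
    ((L.map fun a => d (q a)).sum + (L.map fun a => d (q a)).sum) (hc.edgeFinite hfin) ?_)
  intro u u' huu
  have h1 := hbound u
  have h2 := hbound u'
  have h3 := Z.isTree.connected.dist_triangle (u := u) (v := q (s₀ (f u))) (w := u')
  have h4 : d u' = Z.graph.dist (q (s₀ (f u))) u' := by
    rw [SimpleGraph.dist_comm, huu]
  change Z.graph.dist u (q (s₀ (f u))) ≤ _ at h1
  omega

theorem exists_orbit_list {α : Type*} (act : G → α → α) (act_one : ∀ a, act 1 a = a)
    (act_mul : ∀ g h a, act (g * h) a = act g (act h a))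
    (hfin : Finite (Quot fun a b => ∃ g, act g a = b)) :
    ∃ l : List α, ∀ a, ∃ a₀ ∈ l, ∃ g, a = act g a₀ := by
  have key : ∀ a b, Relation.EqvGen (fun a b => ∃ g, act g a = b) a b → ∃ g, act g a = b := by
    intro a b h
    induction h with
    | rel _ _ h => exact h
    | refl a => exact ⟨1, act_one a⟩
    | symm _ _ _ ih =>
      obtain ⟨g, rfl⟩ := ih
      exact ⟨g⁻¹, by rw [← act_mul, inv_mul_cancel, act_one]⟩
    | trans _ _ _ _ _ ih ih' =>
      obtain ⟨g, rfl⟩ := ih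
      obtain ⟨h, rfl⟩ := ih'
      exact ⟨h * g, act_mul h g _⟩
  have := Fintype.ofFinite (Quot fun a b => ∃ g, act g a = b)
  refine ⟨(Finset.univ : Finset (Quot fun a b => ∃ g, act g a = b)).toList.map Quot.out,
    fun a => ⟨(Quot.mk (fun a b => ∃ g, act g a = b) a).out,
      List.mem_map_of_mem (Finset.mem_toList.2 (Finset.mem_univ _)), ?_⟩⟩
  obtain ⟨g, hg⟩ := key _ _ (Quot.eqvGen_exact
    (Quot.out_eq (Quot.mk (fun a b => ∃ g, act g a = b) a)))
  exact ⟨g, hg.symm⟩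

theorem Cocompact.vertexFinite {X : GTree G} (h : X.Cocompact) : VertexFinite X :=
  exists_orbit_list X.smul X.smul_one X.smul_mul h.1

theorem Cocompact.edgeFinite {X : GTree G} (h : X.Cocompact) : EdgeFinite X := by
  obtain ⟨l, hl⟩ := exists_orbit_list (edgeSmul (X := X))
    (fun e => Subtype.ext (Prod.ext (X.smul_one _) (X.smul_one _)))
    (fun g h e => Subtype.ext (Prod.ext (X.smul_mul g h _) (X.smul_mul g h _))) h.2
  refine ⟨l.map Subtype.val, fun u v huv _ => ?_⟩
  obtain ⟨e, he, g, hg⟩ := hl ⟨(u, v), huv⟩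
  have hg' := congrArg Subtype.val hg
  exact ⟨_, List.mem_map_of_mem he, g, Or.inl ⟨congrArg Prod.fst hg', congrArg Prod.snd hg'⟩⟩

/-- The restriction of the action to a subgroup. -/
def restrict (X : GTree G) (H : Subgroup G) : GTree H where
  V := X.V
  graph := X.graph
  isTree := X.isTree
  smul h := X.smul h
  smul_one := X.smul_one
  smul_mul g h := X.smul_mul g h
  smul_adj h := X.smul_adj h
  no_inversions h := X.no_inversions h

/-- If point stabilizers of `X` are elliptic in `Y`, then there is an equivariant map. -/
theorem exists_equivariant {X Y : GTree G}
    (h : ∀ x, ∃ y, ∀ g, X.smul g x = x → Y.smul g y = y) :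
    ∃ φ : X.V → Y.V, Equivariant φ := by
  let S : Setoid X.V :=
    { r := fun x x' => ∃ g, x' = X.smul g x
      iseqv :=
        { refl := fun x => ⟨1, (X.smul_one x).symm⟩
          symm := by
            rintro x _ ⟨g, rfl⟩
            exact ⟨g⁻¹, (X.inv_smul_smul g x).symm⟩
          trans := by
            rintro x _ _ ⟨g, rfl⟩ ⟨h, rfl⟩
            exact ⟨h * g, (X.smul_mul h g x).symm⟩ } }
  let r : X.V → X.V := fun x => (Quotient.mk S x).out
  have hr : ∀ g x, r (X.smul g x) = r x := fun g x =>
    (congrArg Quotient.out (Quotient.sound (s := S) (a := x) (b := X.smul g x) ⟨g, rfl⟩)).symm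
  have hγ : ∀ x, ∃ g, x = X.smul g (r x) := fun x => Quotient.mk_out (s := S) x
  choose γ hγ using hγ
  choose y hy using h
  refine ⟨fun x => Y.smul (γ x) (y (r x)), fun g x => ?_⟩
  have hfix : X.smul ((g * γ x)⁻¹ * γ (X.smul g x)) (r x) = r x := by
    have h1 := hγ (X.smul g x)
    rw [hr] at h1
    rw [X.smul_mul, ← h1]
    have h2 : X.smul g x = X.smul (g * γ x) (r x) := by rw [X.smul_mul, ← hγ x]
    rw [h2, X.inv_smul_smul]
  have := congrArg (Y.smul (g * γ x)) (hy _ _ hfix)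
  rw [← Y.smul_mul, mul_inv_cancel_left, Y.smul_mul g] at this
  change Y.smul (γ (X.smul g x)) (y (r (X.smul g x))) = Y.smul g (Y.smul (γ x) (y (r x)))
  rw [hr, this]

/-- If all elliptic elements of `X` are elliptic in `Y` and the vertex stabilizers of `X` have
property (E), then there is an equivariant map. -/
theorem exists_equivariant_of_elliptic {X Y : GTree G} (hE : ∀ x, PropertyE ↥(X.stab x))
    (h : ∀ γ, X.Elliptic γ → Y.Elliptic γ) : ∃ φ : X.V → Y.V, Equivariant φ := by
  refine exists_equivariant fun x => ?_
  obtain ⟨y, hy⟩ := hE x (Y.restrict (X.stab x)) fun γ => h γ ⟨x, γ.2⟩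
  exact ⟨y, fun g hg => hy ⟨g, hg⟩⟩

theorem Collapse.elliptic_iff {X Y : GTree G} (h : Collapse X Y) (γ : G) :
    X.Elliptic γ ↔ Y.Elliptic γ := by
  obtain ⟨φ, e, hstab, hne, hsurj, heq, hφ, -⟩ := h
  constructor
  · rintro ⟨x, hx⟩
    exact ⟨φ x, by rw [← heq, hx]⟩
  · rintro ⟨y, hy⟩
    obtain ⟨u, rfl⟩ := hsurj y
    rw [← heq, hφ] at hy
    have hκ : ∀ w, ∃ v, (∀ g, w = X.smul g (d0 e) → v = X.smul g (d1 e)) ∧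
        ((∀ g, w ≠ X.smul g (d0 e)) → v = w) := by
      intro w
      by_cases hw : ∃ g, w = X.smul g (d0 e)
      · obtain ⟨g, rfl⟩ := hw
        refine ⟨X.smul g (d1 e), fun g' hg' => ?_, fun hn => absurd rfl (hn g)⟩
        have hmem : g'⁻¹ * g ∈ X.stab (d0 e) := by
          change X.smul _ _ = _
          rw [X.smul_mul, hg', inv_smul_smul]
        rw [← hstab] at hmem
        have h1 : X.smul (g'⁻¹ * g) (d1 e) = d1 e := hmem.2
        rw [X.smul_mul] at h1
        rw [← h1, smul_inv_smul, h1]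
      · exact ⟨w, fun g hg => absurd ⟨g, hg⟩ hw, fun _ => rfl⟩
    choose κ hκ₀ hκ₁ using hκ
    have hd1 : ∀ g, κ (X.smul g (d1 e)) = X.smul g (d1 e) := fun g => hκ₁ _ fun g' hg' =>
      hne (g⁻¹ * g') (by rw [X.smul_mul, ← hg', inv_smul_smul])
    have hequiv : ∀ g w, κ (X.smul g w) = X.smul g (κ w) := by
      intro g w
      by_cases hw : ∃ g', w = X.smul g' (d0 e)
      · obtain ⟨g', rfl⟩ := hw
        rw [hκ₀ _ g' rfl, ← X.smul_mul, ← X.smul_mul, hκ₀ _ (g * g') rfl]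
      · rw [hκ₁ w fun g' hg' => hw ⟨g', hg'⟩]
        refine hκ₁ _ fun g' hg' => hw ⟨g⁻¹ * g', ?_⟩
        rw [X.smul_mul, ← hg', inv_smul_smul]
    refine ⟨κ u, ?_⟩
    rw [← hequiv]
    clear hφ
    generalize X.smul γ u = v at hy
    induction hy with
    | rel a b hab =>
      obtain ⟨g, rfl, rfl⟩ := hab
      rw [hκ₀ _ g rfl, hd1]
    | refl => rfl
    | symm _ _ _ ih => exact ih.symm
    | trans _ _ _ _ _ ih ih' => exact ih.trans ih'

theorem ElemDeformation.elliptic_iff {X Y : GTree G} (h : ElemDeformation X Y) (γ : G) :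
    X.Elliptic γ ↔ Y.Elliptic γ := by
  induction h with
  | rel _ _ h => exact h.elliptic_iff γ
  | refl => rfl
  | symm _ _ _ ih => exact ih.symm
  | trans _ _ _ _ _ ih ih' => exact ih.trans ih'

theorem transLen_eq_zero_iff (X : GTree G) (γ : G) : X.transLen γ = 0 ↔ X.Elliptic γ := by
  have := X.isTree.connected.nonempty
  rw [transLen, Nat.sInf_eq_zero, or_iff_left (Set.range_nonempty _).ne_empty]
  refine exists_congr fun x => ?_
  rw [X.isTree.connected.dist_eq_zero_iff]
  exact eq_comm

end GTree

open GTree in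
/-- Corollary 4.3: let `X` and `Y` be cocompact `G`-trees whose vertex
stabilizers all have property (E).  The following are equivalent:
(1) `X` and `Y` are related by an elementary deformation;
(2) `X` and `Y` define the same partition of `G` into elliptic and hyperbolic
    elements;
(3) the length functions `ℓ_X` and `ℓ_Y` vanish on the same elements of `G`. -/
theorem elemDeformation_iff_samePartition_iff_lengthVanishing {G : Type u} [Group G]
    (X Y : GTree G) (hXc : X.Cocompact) (hYc : Y.Cocompact)
    (hEX : ∀ x : X.V, PropertyE ↥(X.stab x))
    (hEY : ∀ y : Y.V, PropertyE ↥(Y.stab y)) :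
    (ElemDeformation X Y ↔ ∀ γ : G, X.Elliptic γ ↔ Y.Elliptic γ) ∧
    ((∀ γ : G, X.Elliptic γ ↔ Y.Elliptic γ) ↔
      ∀ γ : G, X.transLen γ = 0 ↔ Y.transLen γ = 0) := by
  refine ⟨⟨fun h γ => h.elliptic_iff γ, fun h => ?_⟩, ?_⟩
  · obtain ⟨φ, hφ⟩ := exists_equivariant_of_elliptic hEX fun γ => (h γ).1
    obtain ⟨ψ, hψ⟩ := exists_equivariant_of_elliptic hEY fun γ => (h γ).2
    exact elemDeformation_of_equivariant hφ hψ hXc.edgeFinite hXc.vertexFinite hYc.vertexFinite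
  · simp only [transLen_eq_zero_iff]
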